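/- arXiv:1611.06038 — 2 statements merged into one kernel-verified Lean document; each statement's English description precedes it below -/
import Mathlib

section
/- In any execution of the algorithm MaxMatch, the total number of moves in which a single vertex changes the value of its end variable (from True to False or from False to True) is at most σ + 6μ. -/
open Classical

section MaxMatchPreamble

variable {V : Type*} [Fintype V] [LinearOrder V]

/-- Strict comparison on identifiers where `none` (null) counts as greater
than every identifier. -/
def optLT : Option V → Option V → Prop
  | some x, some y => x < y
  | some _, none => True
  | none, _ => False

/-- A configuration of the MaxMatch algorithm: the variables `p`, `α`, `β`
(`a`,`b` here) and the booleans `s`, `end` (`e` here) of every vertex. -/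
structure MMConfig (V : Type*) where
  p : V → Option V
  a : V → Option V
  b : V → Option V
  s : V → Bool
  e : V → Bool

/-- The local state of one vertex. -/
structure MMLocal (V : Type*) where
  p : Option V
  a : Option V
  b : Option V
  s : Bool
  e : Bool

/-- The local state of vertex `u` in configuration `C`. -/
def MMConfig.loc (C : MMConfig V) (u : V) : MMLocal V :=
  ⟨C.p u, C.a u, C.b u, C.s u, C.e u⟩

/-- `m` encodes a maximal matching of `G`: `m u = some v` iff `(u,v)` is a
matching edge, `m u = none` iff `u` is single. -/
structure MaxMatchingOn (G : SimpleGraph V) (m : V → Option V) : Prop where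
  adj : ∀ u v, m u = some v → G.Adj u v
  symm : ∀ u v, m u = some v → m v = some u
  maximal : ∀ u v, G.Adj u v → m u ≠ none ∨ m v ≠ none

/-- `Lowest(S)`: the minimum-identifier element of `S`, `none` if `S = ∅`. -/
noncomputable def lowestSet (S : Set V) : Option V :=
  if h : (Finset.univ.filter fun x => x ∈ S).Nonempty
  then some ((Finset.univ.filter fun x => x ∈ S).min' h) else none

/-- `Lowest` of a finite set of identifiers-or-null: `none` (null) elements are
greater than all identifiers, hence ignored. -/
noncomputable def lowestOpt (S : Finset (Option V)) : Option V :=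
  lowestSet {x : V | some x ∈ S}

/-- Truth value of a proposition. -/
noncomputable def pb (P : Prop) : Bool := if P then true else false

variable (G : SimpleGraph V) (m : V → Option V)

/-- The candidate set considered by `BestRematch(u)`. -/
def candSet (C : MMConfig V) (u : V) : Set V :=
  {x | G.Adj u x ∧ m x = none ∧ (C.p x = some u ∨ C.e x = false)}

/-- `BestRematch(u)`. -/
noncomputable def bestRematch (C : MMConfig V) (u : V) : Option V × Option V :=
  let a := lowestSet (candSet G m C u)
  (a, a.elim none fun w => lowestSet (candSet G m C u \ {w}))

/-- `AskFirst(u)`. -/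
noncomputable def askFirst (C : MMConfig V) (u : V) : Option V :=
  match m u with
  | none => none
  | some v =>
      if C.a u ≠ none ∧ C.a v ≠ none ∧
         2 ≤ ({C.a u, C.b u, C.a v, C.b v} : Finset (Option V)).card ∧
         (optLT (C.a u) (C.a v) ∨ (C.a u = C.a v ∧ C.b u = none) ∨
          (C.a u = C.a v ∧ C.b v ≠ none ∧ u < v))
      then C.a u else none

/-- `AskSecond(u)`. -/
noncomputable def askSecond (C : MMConfig V) (u : V) : Option V :=
  match m u with
  | none => none
  | some v =>
      if askFirst m C v ≠ none
      then lowestOpt (({C.a u, C.b u} : Finset (Option V)) \ {C.a v})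
      else none

/-- `Ask(u)`. -/
noncomputable def ask (C : MMConfig V) (u : V) : Option V :=
  if askFirst m C u = none then askSecond m C u else askFirst m C u

/-- Guard of rule `ResetEnd` (single vertices). -/
def guardResetEnd (C : MMConfig V) (x : V) : Prop :=
  C.p x = none ∧ C.e x = true

/-- Guard of rule `UpdateP` (single vertices). -/
def guardUpdateP (C : MMConfig V) (x : V) : Prop :=
  (C.p x = none ∧ ∃ w, G.Adj x w ∧ m w ≠ none ∧ C.p w = some x) ∨
  (∃ w, C.p x = some w ∧ ¬ (G.Adj x w ∧ m w ≠ none)) ∨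
  (∃ w, C.p x = some w ∧ C.p w ≠ some x)

/-- Guard of rule `UpdateEnd` (single vertices). -/
def guardUpdateEnd (C : MMConfig V) (x : V) : Prop :=
  ∃ w, C.p x = some w ∧ G.Adj x w ∧ m w ≠ none ∧ C.p w = some x ∧ C.e x ≠ C.e w

/-- `o ∈ single(N(u)) ∪ {null}`. -/
def inSNopt (u : V) (o : Option V) : Prop :=
  o = none ∨ ∃ w, o = some w ∧ G.Adj u w ∧ m w = none

/-- First part (first four disjuncts) of the guard of rule `Update`. -/
def guardUpdateA (C : MMConfig V) (u : V) : Prop :=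
  optLT (C.b u) (C.a u) ∨
  (¬ inSNopt G m u (C.a u) ∨ ¬ inSNopt G m u (C.b u)) ∨
  (C.a u = C.b u ∧ C.a u ≠ none) ∨
  ¬ inSNopt G m u (C.p u)

/-- Guard of rule `Update` (matched vertices). -/
def guardUpdate (C : MMConfig V) (u : V) : Prop :=
  guardUpdateA G m C u ∨
  ((C.a u, C.b u) ≠ bestRematch G m C u ∧
    (C.p u = none ∨ ∃ w, C.p u = some w ∧ C.p w ≠ some u ∧ C.e w = true))

/-- `p_{p_u} = u`. -/
def ppEq (C : MMConfig V) (u : V) : Prop :=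
  ∃ w, C.p u = some w ∧ C.p w = some u

/-- Value assigned to `s_u` by `MatchFirst` (`v = m_u`). -/
def mfS (C : MMConfig V) (u v : V) : Prop :=
  C.p u = askFirst m C u ∧ ppEq C u ∧ (C.p v = askSecond m C v ∨ C.p v = none)

/-- Value assigned to `end_u` by `MatchFirst` (`v = m_u`). -/
def mfE (C : MMConfig V) (u v : V) : Prop :=
  C.p u = askFirst m C u ∧ ppEq C u ∧ C.s u = true ∧
  C.p v = askSecond m C v ∧ C.e v = true

/-- Guard of rule `MatchFirst` (matched vertices). -/
def guardMatchFirst (C : MMConfig V) (u : V) : Prop :=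
  askFirst m C u ≠ none ∧ ∃ v, m u = some v ∧
    (C.p u ≠ askFirst m C u ∨ ¬ (C.s u = true ↔ mfS m C u v) ∨
     ¬ (C.e u = true ↔ mfE m C u v))

/-- Value assigned to `end_u` (and then `s_u`) by `MatchSecond` (`v = m_u`). -/
def msE (C : MMConfig V) (u v : V) : Prop :=
  C.p u = askSecond m C u ∧ ppEq C u ∧ C.p v = askFirst m C v

/-- Guard of rule `MatchSecond` (matched vertices). -/
def guardMatchSecond (C : MMConfig V) (u : V) : Prop :=
  askSecond m C u ≠ none ∧ ∃ v, m u = some v ∧ C.s v = true ∧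
    (C.p u ≠ askSecond m C u ∨ ¬ (C.e u = true ↔ msE m C u v) ∨ C.s u ≠ C.e u)

/-- Guard of rule `ResetMatch` (matched vertices). -/
def guardResetMatch (C : MMConfig V) (u : V) : Prop :=
  (askFirst m C u = none ∧ askSecond m C u = none ∧
    ¬ (C.p u = none ∧ C.s u = false ∧ C.e u = false)) ∨
  (askSecond m C u ≠ none ∧ C.p u ≠ none ∧ ∃ v, m u = some v ∧ C.s v = false)

/-- The local state of `u` after it atomically executes the command of its
highest-priority true-guard rule (its state is unchanged if no guard holds). -/
noncomputable def localNext (C : MMConfig V) (u : V) : MMLocal V :=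
  if m u = none then
    if guardResetEnd C u then ⟨C.p u, C.a u, C.b u, C.s u, false⟩
    else if guardUpdateP G m C u then
      ⟨lowestSet {w | G.Adj u w ∧ C.p w = some u}, C.a u, C.b u, C.s u, false⟩
    else if guardUpdateEnd G m C u then
      ⟨C.p u, C.a u, C.b u, C.s u, (C.p u).elim (C.e u) C.e⟩
    else C.loc u
  else
    if guardUpdate G m C u then
      ⟨none, (bestRematch G m C u).1, (bestRematch G m C u).2, false, false⟩
    else if guardMatchFirst m C u then
      ⟨askFirst m C u, C.a u, C.b u,
        pb (∃ v, m u = some v ∧ mfS m C u v),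
        pb (∃ v, m u = some v ∧ mfE m C u v)⟩
    else if guardMatchSecond m C u then
      ⟨askSecond m C u, C.a u, C.b u,
        pb (∃ v, m u = some v ∧ msE m C u v),
        pb (∃ v, m u = some v ∧ msE m C u v)⟩
    else if guardResetMatch m C u then ⟨none, C.a u, C.b u, false, false⟩
    else C.loc u

/-- `u` is activable (eligible for some rule) in `C`. -/
def Activable (C : MMConfig V) (u : V) : Prop :=
  (m u = none ∧ (guardResetEnd C u ∨ guardUpdateP G m C u ∨ guardUpdateEnd G m C u)) ∨
  (m u ≠ none ∧ (guardUpdate G m C u ∨ guardMatchFirst m C u ∨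
    guardMatchSecond m C u ∨ guardResetMatch m C u))

/-- A configuration is stable when no vertex is activable. -/
def Stable (C : MMConfig V) : Prop := ∀ u, ¬ Activable G m C u

/-- One transition of the adversarial distributed daemon: the nonempty set `A`
of activable vertices simultaneously execute their (highest-priority) rules. -/
def StepOn (C C' : MMConfig V) (A : Set V) : Prop :=
  A.Nonempty ∧ (∀ u ∈ A, Activable G m C u) ∧
  (∀ u ∈ A, C'.loc u = localNext G m C u) ∧
  (∀ u, u ∉ A → C'.loc u = C.loc u)

/-- A (maximal) execution, padded with stuttering once a stable configuration is
reached: at each index either a genuine transition occurs, or the configuration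
is stable and nothing moves.  `u ∈ act i` means `u` makes a move in transition
`i ↦ i+1`. -/
structure MMExecution (G : SimpleGraph V) (m : V → Option V) where
  cfg : ℕ → MMConfig V
  act : ℕ → Set V
  valid : ∀ i, StepOn G m (cfg i) (cfg (i+1)) (act i) ∨
    (act i = ∅ ∧ Stable G m (cfg i) ∧ cfg (i+1) = cfg i)

/-- μ: the number of matched vertices. -/
noncomputable def muV : ℕ := (Finset.univ.filter fun u : V => m u ≠ none).card

/-- σ: the number of single vertices. -/
noncomputable def sigmaV : ℕ := (Finset.univ.filter fun u : V => m u = none).card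

/-- The matching `M` as a relation. -/
def Mrel (a b : V) : Prop := m a = some b

/-- The output edge set `M⁺` of a configuration, as a relation. -/
def Mplus (C : MMConfig V) (a b : V) : Prop :=
  (m a = some b ∧ C.p a = none ∧ C.p b = none) ∨
  (G.Adj a b ∧ m a ≠ some b ∧ C.p a = some b ∧ C.p b = some a)

/-- `(x,u,v,y)` is a 3-augmenting path on `(G, M')`. -/
def IsAug3 (M' : V → V → Prop) (x u v y : V) : Prop :=
  x ≠ u ∧ x ≠ v ∧ x ≠ y ∧ u ≠ v ∧ u ≠ y ∧ v ≠ y ∧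
  G.Adj x u ∧ G.Adj u v ∧ G.Adj v y ∧
  M' u v ∧ ¬ M' x u ∧ ¬ M' v y

end MaxMatchPreamble

section MaxMatchEndFlips

set_option linter.unusedSectionVars false

variable {V : Type*} [Fintype V] [LinearOrder V] {G : SimpleGraph V} {m : V → Option V}

theorem pb_eq_true {P : Prop} : pb P = true ↔ P := by simp [pb]

theorem mem_of_lowestSet_eq_some {S : Set V} {x : V} (h : lowestSet S = some x) : x ∈ S := by
  unfold lowestSet at h
  split_ifs at h with hn
  have := Finset.min'_mem _ hn
  simp only [Option.some.injEq] at h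
  rw [h] at this
  simpa using this

theorem le_of_lowestSet_eq_some {S : Set V} {x y : V} (h : lowestSet S = some x) (hy : y ∈ S) :
    x ≤ y := by
  unfold lowestSet at h
  split_ifs at h with hn
  simp only [Option.some.injEq] at h
  rw [← h]
  exact Finset.min'_le _ _ (by simpa using hy)

theorem askFirst_mem {C : MMConfig V} {u : V} (h : askFirst m C u ≠ none) :
    askFirst m C u = C.a u := by
  unfold askFirst at h ⊢
  split at h
  · exact absurd rfl h
  · split_ifs at h ⊢
    · rfl
    · exact absurd rfl h

theorem askSecond_mem {C : MMConfig V} {u : V} (h : askSecond m C u ≠ none) :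
    askSecond m C u = C.a u ∨ askSecond m C u = C.b u := by
  obtain ⟨y, hy⟩ := Option.ne_none_iff_exists'.1 h
  rw [hy]
  unfold askSecond at hy
  split at hy
  · simp at hy
  · split_ifs at hy
    have := mem_of_lowestSet_eq_some hy
    simp only [Set.mem_ofPred_eq, Finset.mem_sdiff, Finset.mem_insert, Finset.mem_singleton] at this
    exact this.1

theorem askFirst_partner_ne_none {C : MMConfig V} {u v : V} (huv : m u = some v)
    (h : askSecond m C u ≠ none) : askFirst m C v ≠ none := by
  intro hv
  apply h
  simp [askSecond, huv, hv]

/-- A vertex is never both First and Second. -/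
theorem askSecond_eq_none {C : MMConfig V} {u v : V} (huv : m u = some v) (hvu : m v = some u)
    (h : askFirst m C u ≠ none) : askSecond m C u = none := by
  by_contra hs
  have hv := askFirst_partner_ne_none huv hs
  have hcmp : ∀ {x y : V}, m x = some y → askFirst m C x ≠ none → C.a x ≠ none ∧
      (optLT (C.a x) (C.a y) ∨ (C.a x = C.a y ∧ C.b x = none) ∨
        (C.a x = C.a y ∧ C.b y ≠ none ∧ x < y)) := by
    intro x y hxy hx
    simp only [askFirst, hxy] at hx
    split_ifs at hx with hc
    · exact ⟨hc.1, hc.2.2.2⟩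
    · exact absurd rfl hx
  obtain ⟨hau, hu⟩ := hcmp huv h
  obtain ⟨hav, hv⟩ := hcmp hvu hv
  obtain ⟨x, hx⟩ := Option.ne_none_iff_exists'.1 hau
  obtain ⟨y, hy⟩ := Option.ne_none_iff_exists'.1 hav
  have hmem := askSecond_mem hs
  have hne : askSecond m C u ≠ C.a v := by
    obtain ⟨z, hz⟩ := Option.ne_none_iff_exists'.1 hs
    rw [hz]
    simp only [askSecond, huv] at hz
    split_ifs at hz
    have := mem_of_lowestSet_eq_some hz
    simp only [Set.mem_ofPred_eq, Finset.mem_sdiff, Finset.mem_singleton] at this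
    exact this.2
  rw [hx, hy] at hu hv
  simp only [optLT, Option.some.injEq] at hu hv
  have hxy : x = y := by
    rcases hu with h1 | h1 | h1
    · rcases hv with h2 | h2 | h2
      · exact absurd h1 h2.asymm
      · exact h2.1.symm
      · exact h2.1.symm
    · exact h1.1
    · exact h1.1
  subst hxy
  simp only [lt_irrefl, true_and, false_or] at hu hv
  have hb : C.b u = none := by
    by_contra hb
    have h1 := hu.resolve_left hb
    have h2 := hv.resolve_left h1.1
    exact h1.2.asymm h2.2
  rcases hmem with h1 | h1
  · exact hne (by rw [h1, hx, hy])
  · exact hs (by rw [h1, hb])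

/-- `Ask` values depend only on the `α`, `β` variables of the two partners. -/
theorem askFirst_congr {C C' : MMConfig V} {u v : V} (huv : m u = some v)
    (hau : C'.a u = C.a u) (hbu : C'.b u = C.b u) (hav : C'.a v = C.a v) (hbv : C'.b v = C.b v) :
    askFirst m C' u = askFirst m C u := by
  simp only [askFirst, huv, hau, hbu, hav, hbv]

theorem askSecond_congr {C C' : MMConfig V} {u v : V} (huv : m u = some v) (hvu : m v = some u)
    (hau : C'.a u = C.a u) (hbu : C'.b u = C.b u) (hav : C'.a v = C.a v) (hbv : C'.b v = C.b v) :
    askSecond m C' u = askSecond m C u := by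
  simp only [askSecond, huv, hau, hbu, hav, askFirst_congr hvu hav hbv hau hbu]

/-- A relaxed transition: every vertex either keeps its state or executes its rule. -/
def RelaxedStep (G : SimpleGraph V) (m : V → Option V) (C C' : MMConfig V) : Prop :=
  ∀ w, C'.loc w = C.loc w ∨ C'.loc w = localNext G m C w

theorem loc_eq_iff {C : MMConfig V} {u : V} {L : MMLocal V} :
    C.loc u = L ↔ C.p u = L.p ∧ C.a u = L.a ∧ C.b u = L.b ∧ C.s u = L.s ∧ C.e u = L.e := by
  cases L
  simp [MMConfig.loc]

/-- A single vertex married to a matched neighbour keeps its pointer. -/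
theorem RelaxedStep.p_single {C C' : MMConfig V} (hst : RelaxedStep G m C C') {x u : V}
    (hx : m x = none) (hu : m u ≠ none) (hadj : G.Adj x u)
    (hpx : C.p x = some u) (hpu : C.p u = some x) : C'.p x = some u := by
  rcases hst x with h | h
  · rw [loc_eq_iff] at h
    exact h.1.trans hpx
  · have hnP : ¬ guardUpdateP G m C x := by simp [guardUpdateP, hpx, hpu, hadj, hu]
    rw [localNext, if_pos hx, if_neg hnP] at h
    split_ifs at h <;> rw [loc_eq_iff] at h <;> exact h.1.trans hpx

/-- The invariant acquired by a matched vertex through its first move. -/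
def Settled (G : SimpleGraph V) (m : V → Option V) (C : MMConfig V) (u : V) : Prop :=
  ¬ guardUpdateA G m C u ∧ (C.s u = true ∨ C.e u = true → ppEq C u)

theorem guardUpdateA_congr {C C' : MMConfig V} {u : V} (hp : C'.p u = C.p u)
    (ha : C'.a u = C.a u) (hb : C'.b u = C.b u) :
    guardUpdateA G m C' u ↔ guardUpdateA G m C u := by
  simp only [guardUpdateA, hp, ha, hb]

theorem exists_single_of_not_guardUpdateA {C : MMConfig V} {u : V}
    (h : ¬ guardUpdateA G m C u) (hp : C.p u ≠ none) :
    ∃ w, C.p u = some w ∧ G.Adj u w ∧ m w = none := by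
  simp only [guardUpdateA, not_or, not_not] at h
  exact h.2.2.2.resolve_left hp

/-- A mutual pointer between a matched vertex and a single neighbour survives any transition
in which the matched vertex keeps its pointer. -/
theorem RelaxedStep.ppEq_of_p_eq {C C' : MMConfig V} (hst : RelaxedStep G m C C') {u : V}
    (hu : m u ≠ none) (hA : ¬ guardUpdateA G m C' u) (hp : C'.p u = C.p u) (h : ppEq C u) :
    ppEq C' u := by
  obtain ⟨x, h1, h2⟩ := h
  obtain ⟨w, h3, h4, h5⟩ := exists_single_of_not_guardUpdateA hA (by simp [hp, h1])
  obtain rfl : x = w := by simpa [hp, h1] using h3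
  exact ⟨x, h3, hst.p_single h5 hu h4.symm h2 h1⟩

theorem not_guardUpdate_of_ppEq {C : MMConfig V} {u : V} (hA : ¬ guardUpdateA G m C u)
    (h : ppEq C u) : ¬ guardUpdate G m C u := by
  obtain ⟨x, h1, h2⟩ := h
  simp [guardUpdate, hA, h1, h2]

theorem bestRematch_well_formed (C : MMConfig V) (u : V) :
    ¬ optLT (bestRematch G m C u).2 (bestRematch G m C u).1 ∧
    inSNopt G m u (bestRematch G m C u).1 ∧ inSNopt G m u (bestRematch G m C u).2 ∧
    ((bestRematch G m C u).1 = (bestRematch G m C u).2 → (bestRematch G m C u).1 = none) := by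
  have hmem : ∀ {x}, x ∈ candSet G m C u → inSNopt G m u (some x) := fun {x} hx =>
    Or.inr ⟨x, rfl, hx.1, hx.2.1⟩
  simp only [bestRematch]
  cases ha : lowestSet (candSet G m C u) with
  | none => simp [optLT, inSNopt]
  | some x =>
    have hx := mem_of_lowestSet_eq_some ha
    simp only [Option.elim_some]
    cases hb : lowestSet (candSet G m C u \ {x}) with
    | none => exact ⟨by simp [optLT], hmem hx, Or.inl rfl, by simp⟩
    | some y =>
      have hy := mem_of_lowestSet_eq_some hb
      refine ⟨?_, hmem hx, hmem hy.1, ?_⟩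
      · simpa [optLT] using le_of_lowestSet_eq_some ha hy.1
      · intro h
        exact absurd (Option.some.inj h).symm hy.2

theorem not_guardUpdateA_of_p {C C' : MMConfig V} {u : V} (h : ¬ guardUpdateA G m C u)
    (ha : C'.a u = C.a u) (hb : C'.b u = C.b u)
    (hp : C'.p u = none ∨ C'.p u = C.a u ∨ C'.p u = C.b u) : ¬ guardUpdateA G m C' u := by
  simp only [guardUpdateA, not_or, not_not, ha, hb] at h ⊢
  refine ⟨h.1, h.2.1, h.2.2.1, ?_⟩
  rcases hp with hp | hp | hp <;> rw [hp]
  · exact Or.inl rfl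
  · exact h.2.1.1
  · exact h.2.1.2

/-- Effect of the rule executed by a matched vertex which is activable or already settled. -/
theorem localNext_matched {C C' : MMConfig V} {u : V} (hu : m u ≠ none)
    (h : C'.loc u = localNext G m C u) (hact : Activable G m C u ∨ Settled G m C u) :
    ¬ guardUpdateA G m C' u ∧
      (C'.s u = true ∨ C'.e u = true → ppEq C u ∧ C'.p u = C.p u) := by
  rw [localNext, if_neg hu] at h
  split_ifs at h with h1 h2 h3 h4
  · rw [loc_eq_iff] at h
    obtain ⟨hp, ha, hb, hs, he⟩ := h
    obtain ⟨g1, g2, g3, g4⟩ := bestRematch_well_formed (G := G) (m := m) C u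
    refine ⟨?_, by simp [hs, he]⟩
    simp only [guardUpdateA, hp, ha, hb, not_or, not_not, not_and]
    exact ⟨g1, ⟨g2, g3⟩, g4, Or.inl rfl⟩
  · rw [loc_eq_iff] at h
    obtain ⟨hp, ha, hb, hs, he⟩ := h
    refine ⟨not_guardUpdateA_of_p (fun hA => h1 (Or.inl hA)) ha hb
      (Or.inr (Or.inl (hp.trans (askFirst_mem h2.1)))), ?_⟩
    rw [hs, he, pb_eq_true, pb_eq_true]
    rintro (⟨v, -, hm1⟩ | ⟨v, -, hm1⟩) <;> exact ⟨hm1.2.1, hp.trans hm1.1.symm⟩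
  · rw [loc_eq_iff] at h
    obtain ⟨hp, ha, hb, hs, he⟩ := h
    refine ⟨not_guardUpdateA_of_p (fun hA => h1 (Or.inl hA)) ha hb
      (Or.inr ((askSecond_mem h3.1).imp hp.trans hp.trans)), ?_⟩
    rw [hs, he, pb_eq_true]
    rintro (⟨v, -, hm1⟩ | ⟨v, -, hm1⟩) <;> exact ⟨hm1.2.1, hp.trans hm1.1.symm⟩
  · rw [loc_eq_iff] at h
    obtain ⟨hp, ha, hb, hs, he⟩ := h
    exact ⟨not_guardUpdateA_of_p (fun hA => h1 (Or.inl hA)) ha hb (Or.inl hp), by simp [hs, he]⟩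
  · have hset : Settled G m C u := by
      refine hact.resolve_left fun h' => ?_
      simp [Activable, h1, h2, h3, h4, hu] at h'
    rw [loc_eq_iff] at h
    obtain ⟨hp, ha, hb, hs, he⟩ := h
    simp only [MMConfig.loc] at hp ha hb hs he
    rw [hs, he]
    exact ⟨fun hA => hset.1 ((guardUpdateA_congr hp ha hb).1 hA), fun h' => ⟨hset.2 h', hp⟩⟩

theorem RelaxedStep.settled_of_localNext {C C' : MMConfig V} (hst : RelaxedStep G m C C') {u : V}
    (hu : m u ≠ none) (h : C'.loc u = localNext G m C u)
    (hact : Activable G m C u ∨ Settled G m C u) : Settled G m C' u := by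
  obtain ⟨hA, hs⟩ := localNext_matched hu h hact
  exact ⟨hA, fun h' => hst.ppEq_of_p_eq hu hA (hs h').2 (hs h').1⟩

theorem RelaxedStep.settled {C C' : MMConfig V} (hst : RelaxedStep G m C C') {u : V}
    (hu : m u ≠ none) (hset : Settled G m C u) : Settled G m C' u := by
  rcases hst u with h | h
  · rw [loc_eq_iff] at h
    obtain ⟨hp, ha, hb, hs, he⟩ := h
    simp only [MMConfig.loc] at hp ha hb hs he
    have hA : ¬ guardUpdateA G m C' u := fun hA => hset.1 ((guardUpdateA_congr hp ha hb).1 hA)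
    refine ⟨hA, fun h' => hst.ppEq_of_p_eq hu hA hp (hset.2 ?_)⟩
    rwa [hs, he] at h'
  · exact hst.settled_of_localNext hu h (Or.inr hset)

theorem localNext_first {C C' : MMConfig V} {u v : V} (huv : m u = some v) (hvu : m v = some u)
    (hA : ¬ guardUpdateA G m C u) (hpp : ppEq C u) (hp : C.p u = askFirst m C u)
    (hpv : C.p v = askSecond m C v) (h : C'.loc u = localNext G m C u) :
    C'.p u = C.p u ∧ C'.a u = C.a u ∧ C'.b u = C.b u ∧ C'.s u = true ∧
      (C.s u = true → C.e v = true → C'.e u = true) := by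
  have hu : m u ≠ none := by simp [huv]
  have hf : askFirst m C u ≠ none := by
    obtain ⟨x, hx, -⟩ := hpp
    rw [← hp, hx]
    simp
  have hs := askSecond_eq_none huv hvu hf
  have hS : mfS m C u v := ⟨hp, hpp, Or.inl hpv⟩
  rw [localNext, if_neg hu, if_neg (not_guardUpdate_of_ppEq hA hpp)] at h
  have h3 : ¬ guardMatchSecond m C u := by simp [guardMatchSecond, hs]
  have h4 : ¬ guardResetMatch m C u := by simp [guardResetMatch, hs, hf]
  rw [if_neg h3, if_neg h4] at h
  split_ifs at h with h2
  · rw [loc_eq_iff] at h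
    obtain ⟨g1, g2, g3, g4, g5⟩ := h
    refine ⟨g1.trans hp.symm, g2, g3, ?_, fun hsu hev => ?_⟩
    · rw [g4, pb_eq_true]
      exact ⟨v, huv, hS⟩
    · rw [g5, pb_eq_true]
      exact ⟨v, huv, hp, hpp, hsu, hpv, hev⟩
  · rw [loc_eq_iff] at h
    obtain ⟨g1, g2, g3, g4, g5⟩ := h
    simp only [MMConfig.loc] at g1 g2 g3 g4 g5
    have h2' : ¬ (C.p u ≠ askFirst m C u ∨ ¬ (C.s u = true ↔ mfS m C u v) ∨
        ¬ (C.e u = true ↔ mfE m C u v)) := fun h' => h2 ⟨hf, v, huv, h'⟩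
    simp only [not_or, not_not] at h2'
    exact ⟨g1, g2, g3, g4.trans (h2'.2.1.2 hS),
      fun hsu hev => g5.trans (h2'.2.2.2 ⟨hp, hpp, hsu, hpv, hev⟩)⟩

theorem localNext_second {C C' : MMConfig V} {u v : V} (huv : m u = some v) (hvu : m v = some u)
    (hA : ¬ guardUpdateA G m C u) (hpp : ppEq C u) (hp : C.p u = askSecond m C u)
    (hpv : C.p v = askFirst m C v) (hsv : C.s v = true) (h : C'.loc u = localNext G m C u) :
    C'.p u = C.p u ∧ C'.a u = C.a u ∧ C'.b u = C.b u ∧ C'.e u = true := by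
  have hu : m u ≠ none := by simp [huv]
  have hs : askSecond m C u ≠ none := by
    obtain ⟨x, hx, -⟩ := hpp
    rw [← hp, hx]
    simp
  have hf : askFirst m C u = none := by
    by_contra hf
    exact hs (askSecond_eq_none huv hvu hf)
  have hE : msE m C u v := ⟨hp, hpp, hpv⟩
  have h2 : ¬ guardMatchFirst m C u := by simp [guardMatchFirst, hf]
  have h4 : ¬ guardResetMatch m C u := by simp [guardResetMatch, hs, huv, hsv]
  rw [localNext, if_neg hu, if_neg (not_guardUpdate_of_ppEq hA hpp), if_neg h2, if_neg h4] at h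
  split_ifs at h with h3
  · rw [loc_eq_iff] at h
    obtain ⟨g1, g2, g3, g4, g5⟩ := h
    refine ⟨g1.trans hp.symm, g2, g3, ?_⟩
    rw [g5, pb_eq_true]
    exact ⟨v, huv, hE⟩
  · rw [loc_eq_iff] at h
    obtain ⟨g1, g2, g3, g4, g5⟩ := h
    simp only [MMConfig.loc] at g1 g2 g3 g4 g5
    have h3' : ¬ (C.p u ≠ askSecond m C u ∨ ¬ (C.e u = true ↔ msE m C u v) ∨ C.s u ≠ C.e u) :=
      fun h' => h3 ⟨hs, v, huv, hsv, h'⟩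
    simp only [not_or, not_not] at h3'
    exact ⟨g1, g2, g3, g5.trans (h3'.2.1.2 hE)⟩

/-- The situation in which a match rule of `u` (with partner `v`) assigns `True` to `end_u`. -/
def EndReady (G : SimpleGraph V) (m : V → Option V) (C : MMConfig V) (u v : V) : Prop :=
  ¬ guardUpdateA G m C u ∧ ppEq C u ∧
    ((C.p u = askFirst m C u ∧ C.s u = true ∧ C.p v = askSecond m C v ∧ C.e v = true) ∨
     (C.p u = askSecond m C u ∧ C.p v = askFirst m C v ∧ C.s v = true))

theorem RelaxedStep.endReady {C C' : MMConfig V} (hst : RelaxedStep G m C C') {u v : V}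
    (huv : m u = some v) (hvu : m v = some u) (hR : EndReady G m C u v)
    (hu : C.e u = true ∨ C'.loc u = localNext G m C u)
    (hv : C'.loc v = C.loc v ∨ Settled G m C v) :
    EndReady G m C' u v ∧ C'.e u = true := by
  obtain ⟨hA, hpp, hR⟩ := hR
  have finish : ∀ (_ : C'.p u = C.p u) (_ : C'.a u = C.a u) (_ : C'.b u = C.b u),
      ¬ guardUpdateA G m C' u ∧ ppEq C' u := fun h1 h2 h3 =>
    have hA' := fun h' => hA ((guardUpdateA_congr h1 h2 h3).1 h')
    ⟨hA', hst.ppEq_of_p_eq (by simp [huv]) hA' h1 hpp⟩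
  rcases hR with ⟨hp, hsu, hpv, hev⟩ | ⟨hp, hpv, hsv⟩
  · have hU : C'.p u = C.p u ∧ C'.a u = C.a u ∧ C'.b u = C.b u ∧ C'.s u = true ∧
        C'.e u = true := by
      rcases hst u with h | h
      · rcases hu with hu | hu
        · rw [loc_eq_iff] at h
          exact ⟨h.1, h.2.1, h.2.2.1, h.2.2.2.1.trans hsu, h.2.2.2.2.trans hu⟩
        · obtain ⟨g1, g2, g3, g4, g5⟩ := localNext_first huv hvu hA hpp hp hpv hu
          exact ⟨g1, g2, g3, g4, g5 hsu hev⟩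
      · obtain ⟨g1, g2, g3, g4, g5⟩ := localNext_first huv hvu hA hpp hp hpv h
        exact ⟨g1, g2, g3, g4, g5 hsu hev⟩
    have hV : C'.p v = C.p v ∧ C'.a v = C.a v ∧ C'.b v = C.b v ∧ C'.e v = true := by
      have keep : C'.loc v = C.loc v → C'.p v = C.p v ∧ C'.a v = C.a v ∧ C'.b v = C.b v ∧
          C'.e v = true := fun h => by
        rw [loc_eq_iff] at h
        exact ⟨h.1, h.2.1, h.2.2.1, h.2.2.2.2.trans hev⟩
      rcases hv with h | hset
      · exact keep h
      · rcases hst v with h | h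
        · exact keep h
        · exact localNext_second hvu huv hset.1 (hset.2 (Or.inr hev)) hpv hp hsu h
    obtain ⟨u1, u2, u3, u4, u5⟩ := hU
    obtain ⟨v1, v2, v3, v4⟩ := hV
    refine ⟨⟨(finish u1 u2 u3).1, (finish u1 u2 u3).2, Or.inl ⟨?_, u4, ?_, v4⟩⟩, u5⟩
    · rw [u1, hp, askFirst_congr huv u2 u3 v2 v3]
    · rw [v1, hpv, askSecond_congr hvu huv v2 v3 u2 u3]
  · have hU : C'.p u = C.p u ∧ C'.a u = C.a u ∧ C'.b u = C.b u ∧ C'.e u = true := by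
      rcases hst u with h | h
      · rcases hu with hu | hu
        · rw [loc_eq_iff] at h
          exact ⟨h.1, h.2.1, h.2.2.1, h.2.2.2.2.trans hu⟩
        · exact localNext_second huv hvu hA hpp hp hpv hsv hu
      · exact localNext_second huv hvu hA hpp hp hpv hsv h
    have hV : C'.p v = C.p v ∧ C'.a v = C.a v ∧ C'.b v = C.b v ∧ C'.s v = true := by
      have keep : C'.loc v = C.loc v → C'.p v = C.p v ∧ C'.a v = C.a v ∧ C'.b v = C.b v ∧
          C'.s v = true := fun h => by
        rw [loc_eq_iff] at h
        exact ⟨h.1, h.2.1, h.2.2.1, h.2.2.2.1.trans hsv⟩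
      rcases hv with h | hset
      · exact keep h
      · rcases hst v with h | h
        · exact keep h
        · obtain ⟨g1, g2, g3, g4, -⟩ :=
            localNext_first hvu huv hset.1 (hset.2 (Or.inl hsv)) hpv hp h
          exact ⟨g1, g2, g3, g4⟩
    obtain ⟨u1, u2, u3, u4⟩ := hU
    obtain ⟨v1, v2, v3, v4⟩ := hV
    refine ⟨⟨(finish u1 u2 u3).1, (finish u1 u2 u3).2, Or.inr ⟨?_, ?_, v4⟩⟩, u4⟩
    · rw [u1, hp, askSecond_congr huv hvu u2 u3 v2 v3]
    · rw [v1, hpv, askFirst_congr hvu v2 v3 u2 u3]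

/-- A matched vertex switching `end` to `True` does so from an `EndReady` configuration. -/
theorem RelaxedStep.endReady_of_raise {C C' : MMConfig V} (hst : RelaxedStep G m C C') {u v : V}
    (huv : m u = some v) (h0 : C.e u = false) (h1 : C'.e u = true) :
    EndReady G m C u v ∧ C'.loc u = localNext G m C u := by
  have hu : m u ≠ none := by simp [huv]
  rcases hst u with h | h
  · rw [loc_eq_iff] at h
    have := h.2.2.2.2
    simp [MMConfig.loc, h0, h1] at this
  refine ⟨?_, h⟩
  rw [localNext, if_neg hu] at h
  split_ifs at h with g1 g2 g3 g4 <;> rw [loc_eq_iff] at h <;> have he := h.2.2.2.2 <;>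
    rw [h1] at he
  · simp at he
  · obtain ⟨w, hw, k1, k2, k3, k4, k5⟩ := pb_eq_true.1 he.symm
    obtain rfl : v = w := by simpa [huv] using hw
    exact ⟨fun hA => g1 (Or.inl hA), k2, Or.inl ⟨k1, k3, k4, k5⟩⟩
  · obtain ⟨w, hw, k1, k2, k3⟩ := pb_eq_true.1 he.symm
    obtain rfl : v = w := by simpa [huv] using hw
    obtain ⟨-, w, hw, hs, -⟩ := g3
    obtain rfl : v = w := by simpa [huv] using hw
    exact ⟨fun hA => g1 (Or.inl hA), k2, Or.inr ⟨k1, k3, hs⟩⟩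
  · simp at he
  · simp [MMConfig.loc, h0] at he

/-- A matched vertex that still has `end = True` after a transition kept its pointer. -/
theorem RelaxedStep.p_matched {C C' : MMConfig V} (hst : RelaxedStep G m C C') {u : V}
    (hu : m u ≠ none) (h1 : C'.e u = true) : C'.p u = C.p u := by
  rcases hst u with h | h
  · rw [loc_eq_iff] at h
    exact h.1
  rw [localNext, if_neg hu] at h
  split_ifs at h <;> rw [loc_eq_iff] at h <;> have he := h.2.2.2.2 <;> rw [h1] at he
  · simp at he
  · obtain ⟨w, hw, k1, -⟩ := pb_eq_true.1 he.symm
    exact h.1.trans k1.symm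
  · obtain ⟨w, hw, k1, -⟩ := pb_eq_true.1 he.symm
    exact h.1.trans k1.symm
  · simp at he
  · exact h.1

/-- A single vertex switching `end` to `True` is married to a neighbour with `end = True`. -/
theorem RelaxedStep.single_raise {C C' : MMConfig V} (hst : RelaxedStep G m C C') {x : V}
    (hx : m x = none) (h0 : C.e x = false) (h1 : C'.e x = true) :
    ∃ u, m u ≠ none ∧ G.Adj x u ∧ C.p x = some u ∧ C'.p x = some u ∧ C.p u = some x ∧
      C.e u = true := by
  rcases hst x with h | h
  · rw [loc_eq_iff] at h
    have := h.2.2.2.2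
    simp [MMConfig.loc, h0, h1] at this
  rw [localNext, if_pos hx] at h
  split_ifs at h with g1 g2 g3 <;> rw [loc_eq_iff] at h <;> have he := h.2.2.2.2 <;>
    rw [h1] at he
  · simp at he
  · simp at he
  · obtain ⟨w, k1, k2, k3, k4, k5⟩ := g3
    refine ⟨w, k3, k2, k1, h.1.trans k1, k4, ?_⟩
    cases hw : C.e w
    · simp [h0, hw] at k5
    · rfl
  · simp [MMConfig.loc, h0] at he

/-- `u` points to a single neighbour that points back and has `end = True`. -/
def Served (G : SimpleGraph V) (m : V → Option V) (C : MMConfig V) (u : V) : Prop :=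
  ∃ x, m x = none ∧ G.Adj x u ∧ C.p u = some x ∧ C.p x = some u ∧ C.e x = true

theorem RelaxedStep.served {C C' : MMConfig V} (hst : RelaxedStep G m C C') {u : V}
    (hu : m u ≠ none) (h0 : C.e u = true) (h1 : C'.e u = true) (h : Served G m C u) :
    Served G m C' u := by
  obtain ⟨x, hx, hadj, hpu, hpx, hex⟩ := h
  refine ⟨x, hx, hadj, (hst.p_matched hu h1).trans hpu, hst.p_single hx hu hadj hpx hpu, ?_⟩
  rcases hst x with h | h
  · rw [loc_eq_iff] at h
    exact h.2.2.2.2.trans hex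
  · have g1 : ¬ guardResetEnd C x := by simp [guardResetEnd, hpx]
    have g2 : ¬ guardUpdateP G m C x := by simp [guardUpdateP, hpx, hpu, hadj, hu]
    have g3 : ¬ guardUpdateEnd G m C x := by simp [guardUpdateEnd, hpx, hex, h0]
    rw [localNext, if_pos hx, if_neg g1, if_neg g2, if_neg g3, loc_eq_iff] at h
    exact h.2.2.2.2.trans hex

theorem MMExecution.relaxedStep (E : MMExecution G m) (i : ℕ) :
    RelaxedStep G m (E.cfg i) (E.cfg (i + 1)) := by
  intro w
  rcases E.valid i with ⟨-, -, h1, h2⟩ | ⟨-, -, h⟩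
  · by_cases hw : w ∈ E.act i
    · exact Or.inr (h1 w hw)
    · exact Or.inl (h2 w hw)
  · exact Or.inl (by rw [h])

theorem MMExecution.loc_of_notMem (E : MMExecution G m) {i : ℕ} {w : V} (hw : w ∉ E.act i) :
    (E.cfg (i + 1)).loc w = (E.cfg i).loc w := by
  rcases E.valid i with ⟨-, -, -, h2⟩ | ⟨-, -, h⟩
  · exact h2 w hw
  · rw [h]

theorem MMExecution.settled_of_moved (E : MMExecution G m) {u : V} (hu : m u ≠ none) {i j : ℕ}
    (hi : u ∈ E.act i) (hij : i < j) : Settled G m (E.cfg j) u := by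
  induction j, hij using Nat.le_induction with
  | base =>
    rcases E.valid i with ⟨-, h0, h1, -⟩ | ⟨h, -, -⟩
    · exact (E.relaxedStep i).settled_of_localNext hu (h1 u hi) (Or.inl (h0 u hi))
    · simp [h] at hi
  | succ k _ ih => exact (E.relaxedStep k).settled hu ih

/-- Between two switches of `end_u` to `True`, the partner of `u` makes its first move. -/
theorem MMExecution.raise_unique (E : MMExecution G m) {u v : V} (huv : m u = some v)
    (hvu : m v = some u) {i j : ℕ} (hij : i < j)
    (hi0 : (E.cfg i).e u = false) (hi1 : (E.cfg (i + 1)).e u = true)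
    (hj0 : (E.cfg j).e u = false)
    (hmv : (∃ k < j, v ∈ E.act k) → ∃ k < i, v ∈ E.act k) : False := by
  have hv : ∀ k, i ≤ k → k < j →
      (E.cfg (k + 1)).loc v = (E.cfg k).loc v ∨ Settled G m (E.cfg k) v := by
    intro k hik hkj
    by_cases hk : v ∈ E.act k
    · obtain ⟨l, hl, hlv⟩ := hmv ⟨k, hkj, hk⟩
      exact Or.inr (E.settled_of_moved (by simp [hvu]) hlv (by omega))
    · exact Or.inl (E.loc_of_notMem hk)
  have key : ∀ k, i + 1 ≤ k → k ≤ j → EndReady G m (E.cfg k) u v ∧ (E.cfg k).e u = true := by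
    intro k hk
    induction k, hk using Nat.le_induction with
    | base =>
      intro hj
      obtain ⟨hR, hloc⟩ := (E.relaxedStep i).endReady_of_raise huv hi0 hi1
      exact (E.relaxedStep i).endReady huv hvu hR (Or.inr hloc) (hv i le_rfl hij)
    | succ k hk ih =>
      intro hj
      obtain ⟨hR, he⟩ := ih (by omega)
      exact (E.relaxedStep k).endReady huv hvu hR (Or.inl he) (hv k (by omega) (by omega))
  have := (key j hij le_rfl).2
  simp [hj0] at this

/-- The transitions before time `n` in which `x` switches its `end` variable from `b` to `!b`. -/
def MMExecution.flips (E : MMExecution G m) (b : Bool) (x : V) (n : ℕ) : Finset ℕ :=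
  (Finset.range n).filter fun i => (E.cfg i).e x = b ∧ (E.cfg (i + 1)).e x = !b

theorem MMExecution.card_flips_matched_le (E : MMExecution G m) (hm : MaxMatchingOn G m) {u : V}
    (hu : m u ≠ none) (n : ℕ) : (E.flips false u n).card ≤ 2 := by
  obtain ⟨v, huv⟩ := Option.ne_none_iff_exists'.1 hu
  have hvu := hm.symm _ _ huv
  have hle : (E.flips false u n).card ≤ (Finset.univ : Finset Prop).card := by
    refine Finset.card_le_card_of_injOn (fun i => ∃ k < i, v ∈ E.act k)
      (fun _ _ => Finset.mem_coe.2 (Finset.mem_univ _)) ?_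
    intro i hi j hj hij
    simp only [flips, Finset.coe_filter, Set.mem_ofPred_eq, Bool.not_false] at hi hj
    have hij' : (∃ k < i, v ∈ E.act k) ↔ ∃ k < j, v ∈ E.act k := iff_of_eq hij
    rcases lt_trichotomy i j with h | h | h
    · exact (E.raise_unique huv hvu h hi.2.1 hi.2.2 hj.2.1 hij'.2).elim
    · exact h
    · exact (E.raise_unique huv hvu h hj.2.1 hj.2.2 hi.2.1 hij'.1).elim
  simpa using hle

/-- The transitions before time `n` in which a single vertex married to `u` switches its `end`
variable to `True`. -/
def MMExecution.charges (E : MMExecution G m) (u : V) (n : ℕ) : Finset ℕ :=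
  (Finset.range n).filter fun i => ∃ x, m x = none ∧ (E.cfg i).p x = some u ∧
    (E.cfg i).e x = false ∧ (E.cfg (i + 1)).e x = true

theorem MMExecution.card_charges_le (E : MMExecution G m) {u : V} (hu : m u ≠ none) (n : ℕ) :
    (E.charges u n).card + (if (E.cfg n).e u = true ∧ ¬ Served G m (E.cfg n) u then 1 else 0) ≤
      (E.flips false u n).card + 1 := by
  induction n with
  | zero =>
    simp only [charges, flips, Finset.range_zero, Finset.filter_empty, Finset.card_empty]
    split_ifs <;> simp
  | succ n ih =>
    have hst := E.relaxedStep n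
    have hserved := hst.served hu
    have hcharge : (∃ x, m x = none ∧ (E.cfg n).p x = some u ∧
        (E.cfg n).e x = false ∧ (E.cfg (n + 1)).e x = true) →
        ((E.cfg n).e u = true ∧ ¬ Served G m (E.cfg n) u) ∧
        ((E.cfg (n + 1)).e u = true → Served G m (E.cfg (n + 1)) u) := by
      rintro ⟨x, hx, hpx, h0, h1⟩
      obtain ⟨w, -, k2, k3, k4, k5, k6⟩ := hst.single_raise hx h0 h1
      obtain rfl : u = w := by simpa [hpx] using k3
      refine ⟨⟨k6, ?_⟩, fun h => ⟨x, hx, k2, (hst.p_matched hu h).trans k5, k4, h1⟩⟩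
      rintro ⟨y, -, -, hy, -, hey⟩
      obtain rfl : x = y := by simpa [k5] using hy
      simp [h0] at hey
    simp only [charges, flips, Finset.range_add_one, Finset.filter_insert, Bool.not_false] at ih ⊢
    split_ifs at ih ⊢ <;>
      (try simp only [Finset.card_insert_of_notMem, Finset.mem_filter, Finset.mem_range, lt_irrefl,
        false_and, not_false_eq_true]) <;>
      first
      | omega
      | (exfalso; grind)

theorem MMExecution.card_charges_le_three (E : MMExecution G m) (hm : MaxMatchingOn G m) {u : V}
    (hu : m u ≠ none) (n : ℕ) : (E.charges u n).card ≤ 3 := by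
  have h1 := E.card_charges_le hu n
  have h2 := E.card_flips_matched_le hm hu n
  omega

/-- The two kinds of switches of a given vertex alternate. -/
theorem MMExecution.card_flips_true_le (E : MMExecution G m) (x : V) (n : ℕ) :
    (E.flips true x n).card + (if (E.cfg n).e x = true then 1 else 0) ≤
      (E.flips false x n).card + 1 := by
  induction n with
  | zero =>
    simp only [flips, Finset.range_zero, Finset.filter_empty, Finset.card_empty]
    split_ifs <;> simp
  | succ n ih =>
    simp only [flips, Finset.range_add_one, Finset.filter_insert, Bool.not_false,
      Bool.not_true] at ih ⊢
    split_ifs at ih ⊢ <;>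
      (try simp only [Finset.card_insert_of_notMem, Finset.mem_filter, Finset.mem_range, lt_irrefl,
        false_and, not_false_eq_true]) <;>
      first
      | omega
      | (exfalso; grind)

/-- Every switch of a single vertex to `True` is charged to a matched vertex. -/
theorem MMExecution.sum_flips_false_le (E : MMExecution G m) (hm : MaxMatchingOn G m) (n : ℕ) :
    ∑ x with m x = none, (E.flips false x n).card ≤ 3 * muV m := by
  have hcharge : ((Finset.univ.filter fun x => m x = none).sigma
        fun x => E.flips false x n).card ≤
      ((Finset.univ.filter fun u => m u ≠ none).sigma fun u => E.charges u n).card := by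
    refine Finset.card_le_card_of_forall_subsingleton
      (fun q r => q.2 = r.2 ∧ (E.cfg q.2).p q.1 = some r.1 ∧ (E.cfg q.2).p r.1 = some q.1) ?_ ?_
    · rintro ⟨x, i⟩ hq
      simp only [Finset.mem_sigma, Finset.mem_filter, Finset.mem_univ, true_and, flips,
        Finset.mem_range, Bool.not_false] at hq
      obtain ⟨hx, hi, h0, h1⟩ := hq
      obtain ⟨u, hu, -, hpx, -, hpu, -⟩ := (E.relaxedStep i).single_raise hx h0 h1
      refine ⟨⟨u, i⟩, ?_, rfl, hpx, hpu⟩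
      simp only [Finset.mem_sigma, Finset.mem_filter, Finset.mem_univ, true_and, charges,
        Finset.mem_range]
      exact ⟨hu, hi, x, hx, hpx, h0, h1⟩
    · rintro ⟨u, i⟩ - ⟨x, j⟩ ⟨-, hj, -, hx⟩ ⟨y, k⟩ ⟨-, hk, -, hy⟩
      dsimp only at hj hk hx hy
      subst hj hk
      obtain rfl : x = y := by simpa [hx] using hy
      rfl
  rw [Finset.card_sigma, Finset.card_sigma] at hcharge
  refine hcharge.trans ?_
  rw [muV, mul_comm]
  exact Finset.sum_le_card_nsmul _ _ _ fun u hu =>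
    E.card_charges_le_three hm (by simpa using hu) n

end MaxMatchEndFlips

/-- In any execution, single vertices flip their `end` variable in at most
`σ + 6μ` moves in total. -/
theorem stmt3 {V : Type*} [Fintype V] [LinearOrder V]
    (G : SimpleGraph V) (m : V → Option V) (hm : MaxMatchingOn G m)
    (E : MMExecution G m) :
    ∀ T : Finset (ℕ × V),
      (∀ q ∈ T, m q.2 = none ∧ q.2 ∈ E.act q.1 ∧
        (E.cfg q.1).e q.2 ≠ (E.cfg (q.1 + 1)).e q.2) →
      T.card ≤ sigmaV m + 6 * muV m := by
  intro T hT
  obtain ⟨n, hn⟩ : ∃ n, ∀ q ∈ T, q.1 < n :=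
    ⟨T.sup Prod.fst + 1, fun q hq => Nat.lt_succ_of_le (Finset.le_sup (f := Prod.fst) hq)⟩
  have hcard : T.card ≤ ((Finset.univ.filter fun x => m x = none).sigma
      fun x => E.flips true x n ∪ E.flips false x n).card := by
    refine Finset.card_le_card_of_injOn (fun q => ⟨q.2, q.1⟩) ?_ ?_
    · intro q hq
      obtain ⟨h1, -, h2⟩ := hT q hq
      have h3 := hn q hq
      simp only [MMExecution.flips, Finset.coe_sigma, Set.mem_sigma_iff, Finset.mem_coe,
        Finset.mem_filter, Finset.mem_univ, true_and, Finset.mem_union, Finset.mem_range]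
      grind
    · rintro ⟨i, x⟩ - ⟨j, y⟩ - h
      simp only [Sigma.mk.injEq, heq_eq_eq] at h
      rw [h.1, h.2]
  rw [Finset.card_sigma] at hcard
  have hflips : ∀ x, (E.flips true x n ∪ E.flips false x n).card ≤
      2 * (E.flips false x n).card + 1 := fun x => by
    have h1 := Finset.card_union_le (E.flips true x n) (E.flips false x n)
    have h2 := E.card_flips_true_le x n
    omega
  have hsum := hcard.trans (Finset.sum_le_sum fun x _ => hflips x)
  rw [Finset.sum_add_distrib, ← Finset.mul_sum, Finset.sum_const, smul_eq_mul, mul_one] at hsum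
  have hup := E.sum_flips_false_le hm n
  rw [sigmaV]
  omega
end

section
/- In any execution of the algorithm MaxMatch, the matched vertices execute at most 12μ(Δ(σ + 6μ) + μ) rules (moves) in total. -/
open Classical

set_option linter.unusedSectionVars false

namespace MaxMatch

variable {V : Type*} [Fintype V] [LinearOrder V]
  {G : SimpleGraph V} {m : V → Option V} {C C' : MMConfig V} {A : Set V} {u v x : V}

/-! ### Transitions -/

/-- A possibly empty transition: the vertices of `A` are activable and move, the others stay. -/
structure Trans (G : SimpleGraph V) (m : V → Option V) (C C' : MMConfig V) (A : Set V) : Prop where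
  activable : ∀ u ∈ A, Activable G m C u
  move : ∀ u ∈ A, C'.loc u = localNext G m C u
  stay : ∀ u, u ∉ A → C'.loc u = C.loc u

theorem trans_of_execution (E : MMExecution G m) (i : ℕ) :
    Trans G m (E.cfg i) (E.cfg (i + 1)) (E.act i) := by
  rcases E.valid i with ⟨_, h₁, h₂, h₃⟩ | ⟨hA, _, hC⟩
  · exact ⟨h₁, h₂, h₃⟩
  · refine ⟨?_, ?_, ?_⟩ <;> simp [hA, hC]

theorem loc_eq_iff {l : MMLocal V} :
    C.loc u = l ↔ C.p u = l.p ∧ C.a u = l.a ∧ C.b u = l.b ∧ C.s u = l.s ∧ C.e u = l.e := by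
  cases l
  simp [MMConfig.loc]

theorem pb_eq_true {P : Prop} : pb P = true ↔ P := by
  unfold pb
  split_ifs <;> simp_all

theorem Trans.stay_fields (h : Trans G m C C' A) (hu : u ∉ A) :
    C'.p u = C.p u ∧ C'.a u = C.a u ∧ C'.b u = C.b u ∧ C'.s u = C.s u ∧ C'.e u = C.e u :=
  loc_eq_iff.1 (h.stay u hu)

/-- The effect on a matched vertex of executing `Update`. -/
structure DoesUpdate (G : SimpleGraph V) (m : V → Option V) (C C' : MMConfig V) (u : V) :
    Prop where
  guard : guardUpdate G m C u
  p : C'.p u = none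
  ab : (C'.a u, C'.b u) = bestRematch G m C u
  s : C'.s u = false
  e : C'.e u = false

/-- The effect on a matched vertex `u` with partner `v` of executing `MatchFirst`. -/
structure DoesFirst (m : V → Option V) (C C' : MMConfig V) (u v : V) : Prop where
  ask : askFirst m C u ≠ none
  guard : C.p u ≠ askFirst m C u ∨ ¬ (C.s u = true ↔ mfS m C u v) ∨
    ¬ (C.e u = true ↔ mfE m C u v)
  p : C'.p u = askFirst m C u
  s : C'.s u = true ↔ mfS m C u v
  e : C'.e u = true ↔ mfE m C u v

/-- The effect on a matched vertex `u` with partner `v` of executing `MatchSecond`. -/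
structure DoesSecond (m : V → Option V) (C C' : MMConfig V) (u v : V) : Prop where
  ask : askSecond m C u ≠ none
  partner : C.s v = true
  guard : C.p u ≠ askSecond m C u ∨ ¬ (C.e u = true ↔ msE m C u v) ∨ C.s u ≠ C.e u
  p : C'.p u = askSecond m C u
  s : C'.s u = true ↔ msE m C u v
  e : C'.e u = true ↔ msE m C u v

/-- The effect on a matched vertex `u` with partner `v` of executing `ResetMatch`. -/
structure DoesReset (m : V → Option V) (C C' : MMConfig V) (u v : V) : Prop where
  guard : (askFirst m C u = none ∧ askSecond m C u = none ∧
    ¬ (C.p u = none ∧ C.s u = false ∧ C.e u = false)) ∨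
    (askSecond m C u ≠ none ∧ C.p u ≠ none ∧ C.s v = false)
  p : C'.p u = none
  s : C'.s u = false
  e : C'.e u = false

theorem Trans.matched_cases (h : Trans G m C C' A) (hmu : m u = some v) (hu : u ∈ A) :
    DoesUpdate G m C C' u ∨
    (¬ guardUpdate G m C u ∧ C'.a u = C.a u ∧ C'.b u = C.b u ∧
      (DoesFirst m C C' u v ∨ DoesSecond m C C' u v ∨ DoesReset m C C' u v)) := by
  have hact := h.activable u hu
  have hmove := loc_eq_iff.1 (h.move u hu)
  have hne : m u ≠ none := by simp [hmu]
  simp only [Activable, hne, false_and, ne_eq, not_false_eq_true, true_and, false_or] at hact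
  unfold localNext at hmove
  rw [if_neg hne] at hmove
  by_cases h₁ : guardUpdate G m C u
  · rw [if_pos h₁] at hmove
    obtain ⟨hp, ha, hb, hs, he⟩ := hmove
    exact Or.inl ⟨h₁, hp, Prod.ext ha hb, hs, he⟩
  rw [if_neg h₁] at hmove
  right
  by_cases h₂ : guardMatchFirst m C u
  · rw [if_pos h₂] at hmove
    obtain ⟨hp, ha, hb, hs, he⟩ := hmove
    obtain ⟨h₂₁, w, hw, h₂₂⟩ := h₂
    obtain rfl : v = w := Option.some_inj.1 (hmu.symm.trans hw)
    refine ⟨h₁, ha, hb, Or.inl ⟨h₂₁, h₂₂, hp, ?_, ?_⟩⟩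
    · rw [hs, pb_eq_true]; simp [hmu]
    · rw [he, pb_eq_true]; simp [hmu]
  rw [if_neg h₂] at hmove
  by_cases h₃ : guardMatchSecond m C u
  · rw [if_pos h₃] at hmove
    obtain ⟨hp, ha, hb, hs, he⟩ := hmove
    obtain ⟨h₃₁, w, hw, h₃₂, h₃₃⟩ := h₃
    obtain rfl : v = w := Option.some_inj.1 (hmu.symm.trans hw)
    refine ⟨h₁, ha, hb, Or.inr (Or.inl ⟨h₃₁, h₃₂, h₃₃, hp, ?_, ?_⟩)⟩
    · rw [hs, pb_eq_true]; simp [hmu]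
    · rw [he, pb_eq_true]; simp [hmu]
  rw [if_neg h₃] at hmove
  have h₄ : guardResetMatch m C u :=
    ((hact.resolve_left h₁).resolve_left h₂).resolve_left h₃
  rw [if_pos h₄] at hmove
  obtain ⟨hp, ha, hb, hs, he⟩ := hmove
  refine ⟨h₁, ha, hb, Or.inr (Or.inr ⟨?_, hp, hs, he⟩)⟩
  rcases h₄ with h₄ | ⟨h₄, h₅, w, hw, h₆⟩
  · exact Or.inl h₄
  · obtain rfl : v = w := Option.some_inj.1 (hmu.symm.trans hw)
    exact Or.inr ⟨h₄, h₅, h₆⟩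

/-- A single vertex either keeps its pointer or executes `UpdateP`; its `end` variable becomes
true only by copying that of the vertex it is linked to. -/
theorem Trans.single_cases (h : Trans G m C C' A) (hmx : m x = none) :
    (C'.p x = C.p x ∧ C'.e x = C.e x) ∨
    (C'.p x = C.p x ∧ C.p x = none ∧ C'.e x = false) ∨
    (guardUpdateP G m C x ∧ C'.e x = false) ∨
    (C'.p x = C.p x ∧ ∃ w, C.p x = some w ∧ G.Adj x w ∧ m w ≠ none ∧ C.p w = some x ∧
      C'.e x = C.e w) := by
  by_cases hx : x ∈ A
  · have hmove := loc_eq_iff.1 (h.move x hx)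
    unfold localNext at hmove
    rw [if_pos hmx] at hmove
    split_ifs at hmove with h₁ h₂ h₃
    · exact Or.inr (Or.inl ⟨hmove.1, h₁.1, hmove.2.2.2.2⟩)
    · exact Or.inr (Or.inr (Or.inl ⟨h₂, hmove.2.2.2.2⟩))
    · obtain ⟨w, hw, ha, hmw, hpw, _⟩ := h₃
      refine Or.inr (Or.inr (Or.inr ⟨hmove.1, w, hw, ha, hmw, hpw, ?_⟩))
      simpa [hw] using hmove.2.2.2.2
    · exact Or.inl ⟨hmove.1, hmove.2.2.2.2⟩
  · obtain ⟨hp, _, _, _, he⟩ := h.stay_fields hx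
    exact Or.inl ⟨hp, he⟩

/-! ### The functions `Lowest`, `BestRematch`, `AskFirst`, `AskSecond` -/

theorem mem_of_lowestSet {S : Set V} (h : lowestSet S = some x) : x ∈ S ∧ ∀ y ∈ S, x ≤ y := by
  unfold lowestSet at h
  split_ifs at h with hS
  rw [Option.some_inj] at h
  subst h
  refine ⟨by simpa using Finset.min'_mem _ hS, fun y hy => Finset.min'_le _ _ (by simpa using hy)⟩

theorem bestRematch_congr (h : candSet G m C u = candSet G m C' u) :
    bestRematch G m C u = bestRematch G m C' u := by
  simp only [bestRematch, h]

theorem ask_first_eq (h : askFirst m C u ≠ none) : askFirst m C u = C.a u := by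
  unfold askFirst at h ⊢
  split at h
  · simp at h
  · split_ifs at h ⊢
    · rfl
    · simp at h

theorem ask_second_mem (h : askSecond m C u = some x) : C.a u = some x ∨ C.b u = some x := by
  unfold askSecond at h
  split at h
  · simp at h
  · split_ifs at h
    have := (mem_of_lowestSet h).1
    simp only [Set.mem_ofPred_eq, Finset.mem_sdiff, Finset.mem_insert, Finset.mem_singleton] at this
    rcases this.1 with h | h
    · exact Or.inl h.symm
    · exact Or.inr h.symm

theorem ask_first_partner (hmu : m u = some v) (h : askSecond m C u ≠ none) :
    askFirst m C v ≠ none := by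
  simp only [askSecond, hmu] at h
  exact fun h' => h (by simp [h'])

theorem ask_second_eq_none_of_first (hmu : m u = some v) (h : askFirst m C v = none) :
    askSecond m C u = none :=
  by_contra fun h' => ask_first_partner hmu h' h

theorem ask_second_eq_none_of_both (hmu : m u = some v) (hmv : m v = some u)
    (hu : askFirst m C u ≠ none) (hv : askFirst m C v ≠ none) : askSecond m C u = none := by
  by_contra hne
  obtain ⟨y, hy⟩ := Option.ne_none_iff_exists'.1 hne
  have key : C.a u = C.a v ∧ C.b u = none := by
    simp only [askFirst, hmu, hmv, ne_eq, ite_eq_right_iff, not_forall] at hu hv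
    obtain ⟨⟨h1, h2, _, h3⟩, _⟩ := hu
    obtain ⟨⟨_, _, _, h4⟩, _⟩ := hv
    obtain ⟨a, ha⟩ := Option.ne_none_iff_exists'.1 h1
    obtain ⟨b, hb⟩ := Option.ne_none_iff_exists'.1 h2
    rw [ha, hb] at h3 h4
    simp only [optLT, Option.some_inj] at h3 h4
    rw [ha, hb, Option.some_inj]
    rcases h3 with h3 | ⟨rfl, h3⟩ | ⟨rfl, h3, h5⟩
    · rcases h4 with h4 | ⟨rfl, h4⟩ | ⟨rfl, h4, h6⟩
      · exact absurd h3 h4.asymm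
      · exact absurd h3 (lt_irrefl _)
      · exact absurd h3 (lt_irrefl _)
    · exact ⟨rfl, h3⟩
    · rcases h4 with h4 | ⟨_, h4⟩ | ⟨_, _, h6⟩
      · exact absurd h4 (lt_irrefl _)
      · exact absurd h4 h3
      · exact absurd h5 h6.asymm
  simp only [askSecond, hmu, hv, ne_eq, not_false_eq_true, if_true] at hy
  have := (mem_of_lowestSet hy).1
  simp [key] at this

theorem ask_first_eq_none_of_second (hmu : m u = some v) (hmv : m v = some u)
    (h : askSecond m C u ≠ none) : askFirst m C u = none := by
  by_contra h'
  exact h (ask_second_eq_none_of_both hmu hmv h' (ask_first_partner hmu h))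

theorem ask_first_congr (hmu : m u = some v) (hau : C'.a u = C.a u) (hbu : C'.b u = C.b u)
    (hav : C'.a v = C.a v) (hbv : C'.b v = C.b v) : askFirst m C' u = askFirst m C u := by
  simp only [askFirst, hmu, hau, hbu, hav, hbv]

theorem ask_second_congr (hmu : m u = some v) (hmv : m v = some u) (hau : C'.a u = C.a u)
    (hbu : C'.b u = C.b u) (hav : C'.a v = C.a v) (hbv : C'.b v = C.b v) :
    askSecond m C' u = askSecond m C u := by
  simp only [askSecond, hmu, hau, hbu, hav, ask_first_congr hmv hav hbv hau hbu]

theorem in_opt_of_valid (h : ¬ guardUpdateA G m C u) :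
    inSNopt G m u (C.a u) ∧ inSNopt G m u (C.b u) ∧ inSNopt G m u (C.p u) := by
  simp only [guardUpdateA, not_or, not_not] at h
  exact ⟨h.2.1.1, h.2.1.2, h.2.2.2⟩

theorem in_opt_of_ask_first (h : ¬ guardUpdateA G m C u) :
    inSNopt G m u (askFirst m C u) := by
  by_cases hf : askFirst m C u = none
  · exact Or.inl hf
  · rw [ask_first_eq hf]
    exact (in_opt_of_valid h).1

theorem in_opt_of_ask_second (h : ¬ guardUpdateA G m C u) :
    inSNopt G m u (askSecond m C u) := by
  rcases hf : askSecond m C u with _ | x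
  · exact Or.inl rfl
  · rcases ask_second_mem hf with hx | hx <;> rw [← hx]
    exacts [(in_opt_of_valid h).1, (in_opt_of_valid h).2.1]

/-! ### The validity part of the guard of `Update` -/

theorem not_guardUpdateA_of_update (h : DoesUpdate G m C C' u) : ¬ guardUpdateA G m C' u := by
  obtain ⟨_, hp, hab, _, _⟩ := h
  unfold guardUpdateA
  rw [hp]
  have ha : C'.a u = lowestSet (candSet G m C u) := congrArg Prod.fst hab
  have hb : C'.b u = (lowestSet (candSet G m C u)).elim none
    fun w => lowestSet (candSet G m C u \ {w}) := congrArg Prod.snd hab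
  rcases hl : lowestSet (candSet G m C u) with _ | w
  · rw [hl] at ha hb
    simp only [Option.elim] at hb
    simp [ha, hb, optLT, inSNopt]
  · rw [hl] at ha hb
    simp only [Option.elim] at hb
    obtain ⟨hw, hmin⟩ := mem_of_lowestSet hl
    rcases hl' : lowestSet (candSet G m C u \ {w}) with _ | z
    · rw [hl'] at hb
      simp [ha, hb, optLT, inSNopt, hw.1, hw.2.1]
    · rw [hl'] at hb
      have hz := (mem_of_lowestSet hl').1
      have hne : w ≠ z := fun h => hz.2 h.symm
      simp [ha, hb, optLT, inSNopt, hw.1, hw.2.1, hz.1.1, hz.1.2.1, hne, hmin z hz.1]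

theorem Trans.not_guardUpdateA_of_mem (h : Trans G m C C' A) (hmu : m u = some v) (hu : u ∈ A) :
    ¬ guardUpdateA G m C' u := by
  rcases h.matched_cases hmu hu with hup | ⟨hnu, ha, hb, hr⟩
  · exact not_guardUpdateA_of_update hup
  · have hA : ¬ guardUpdateA G m C u := fun h => hnu (Or.inl h)
    have hp : inSNopt G m u (C'.p u) := by
      rcases hr with hr | hr | hr
      · rw [hr.p]; exact in_opt_of_ask_first hA
      · rw [hr.p]; exact in_opt_of_ask_second hA
      · exact Or.inl hr.p
    unfold guardUpdateA at hA ⊢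
    rw [ha, hb]
    tauto

theorem Trans.not_guardUpdateA (h : Trans G m C C' A) (hmu : m u = some v)
    (hA : ¬ guardUpdateA G m C u) : ¬ guardUpdateA G m C' u := by
  by_cases hu : u ∈ A
  · exact h.not_guardUpdateA_of_mem hmu hu
  · obtain ⟨hp, ha, hb, _, _⟩ := h.stay_fields hu
    unfold guardUpdateA at hA ⊢
    rwa [hp, ha, hb]

/-- A single vertex keeps pointing to a matched vertex that points to it. -/
theorem Trans.p_of_link (h : Trans G m C C' A) (hmu : m u = some v)
    (hA : ¬ guardUpdateA G m C u) (hpu : C.p u = some x) (hpx : C.p x = some u) :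
    C'.p x = some u := by
  have hin := (in_opt_of_valid hA).2.2
  simp only [inSNopt, hpu, reduceCtorEq, Option.some_inj, false_or] at hin
  obtain ⟨w, rfl, hadj, hmx⟩ := hin
  rcases h.single_cases hmx with hc | hc | hc | hc
  · rw [hc.1, hpx]
  · rw [hc.1, hpx]
  · exfalso
    have := hc.1
    unfold guardUpdateP at this
    simp [hpx, hpu, hadj.symm, hmu] at this
  · rw [hc.1, hpx]

theorem Trans.linked (h : Trans G m C C' A) (hmu : m u = some v)
    (hA : ¬ guardUpdateA G m C u) (hpp : ppEq C u) (hp : C'.p u = C.p u) : ppEq C' u := by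
  obtain ⟨x, hpu, hpx⟩ := hpp
  exact ⟨x, hp.trans hpu, h.p_of_link hmu hA hpu hpx⟩

/-- The indicator of a proposition. -/
noncomputable def ind (P : Prop) : ℕ := if P then 1 else 0

theorem ind_pos {P : Prop} (h : P) : ind P = 1 := if_pos h

theorem ind_neg {P : Prop} (h : ¬ P) : ind P = 0 := if_neg h

theorem ind_le_one (P : Prop) : ind P ≤ 1 := by
  unfold ind
  split_ifs <;> simp

theorem ind_mono {P Q : Prop} (h : P → Q) : ind P ≤ ind Q := by
  unfold ind
  split_ifs <;> simp_all

/-! ### Executions of `Update` are paid for by changes of `end` at single vertices -/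

theorem Trans.candSet_eq (h : Trans G m C C' A)
    (he : ∀ x, G.Adj u x → m x = none → C'.e x = C.e x) :
    candSet G m C' u = candSet G m C u := by
  ext x
  simp only [candSet, Set.mem_ofPred_eq]
  refine and_congr_right fun hadj => and_congr_right fun hmx => ?_
  have hex := he x hadj hmx
  rcases h.single_cases hmx with hc | hc | hc | hc
  · rw [hc.1, hex]
  · rw [hc.1, hex]
  · simp [← hex, hc.2]
  · rw [hc.1, hex]

/-- `1` if `u` may execute `Update` before any neighbour changes its `end` variable. -/
noncomputable def outdated (G : SimpleGraph V) (m : V → Option V) (C : MMConfig V) (u : V) : ℕ :=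
  ind (guardUpdateA G m C u ∨ (C.a u, C.b u) ≠ bestRematch G m C u)

theorem Trans.outdated_step (h : Trans G m C C' A) (hmu : m u = some v) :
    ind (u ∈ A ∧ guardUpdate G m C u) + outdated G m C' u ≤
      outdated G m C u + ∑ x, ind (G.Adj u x ∧ m x = none ∧ C'.e x ≠ C.e x) := by
  by_cases he : ∀ x, G.Adj u x → m x = none → C'.e x = C.e x
  · have hbr := bestRematch_congr (h.candSet_eq he)
    refine le_add_right ?_
    unfold outdated
    by_cases hu : u ∈ A
    · rcases h.matched_cases hmu hu with hup | ⟨hnu, ha, hb, _⟩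
      · have h₁ : ¬ (guardUpdateA G m C' u ∨ (C'.a u, C'.b u) ≠ bestRematch G m C' u) := by
          rw [hbr, hup.ab]
          simpa using not_guardUpdateA_of_update hup
        have h₂ : guardUpdateA G m C u ∨ (C.a u, C.b u) ≠ bestRematch G m C u :=
          hup.guard.imp_right And.left
        rw [ind_neg h₁, ind_pos h₂]
        exact ind_le_one _
      · rw [ind_neg fun h => hnu h.2, zero_add, ha, hb, hbr]
        exact ind_mono (Or.imp_left fun hg => absurd hg (h.not_guardUpdateA_of_mem hmu hu))
    · rw [ind_neg fun h => hu h.1, zero_add]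
      obtain ⟨hp, ha, hb, _, _⟩ := h.stay_fields hu
      refine ind_mono (Or.imp (fun hg => ?_) fun hg => ?_)
      · by_contra hc
        exact h.not_guardUpdateA hmu hc hg
      · rwa [ha, hb, hbr] at hg
  · push Not at he
    obtain ⟨x, hadj, hmx, hex⟩ := he
    have hx : 1 ≤ ∑ x, ind (G.Adj u x ∧ m x = none ∧ C'.e x ≠ C.e x) := by
      rw [← ind_pos (P := G.Adj u x ∧ m x = none ∧ C'.e x ≠ C.e x) ⟨hadj, hmx, hex⟩]
      exact Finset.single_le_sum (f := fun x => ind (G.Adj u x ∧ m x = none ∧ C'.e x ≠ C.e x))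
        (fun _ _ => Nat.zero_le _) (Finset.mem_univ x)
    have h₁ : ind (u ∈ A ∧ guardUpdate G m C u) ≤ outdated G m C u :=
      ind_mono fun hg => hg.2.imp_right And.left
    have h₂ : outdated G m C' u ≤ 1 := ind_le_one _
    omega

/-! ### Moves of a matched vertex other than `Update` -/

theorem Trans.calm_cases (h : Trans G m C C' A) (hmu : m u = some v)
    (hc : u ∈ A → ¬ guardUpdate G m C u) :
    C'.a u = C.a u ∧ C'.b u = C.b u ∧
    ((u ∉ A ∧ C'.p u = C.p u ∧ C'.s u = C.s u ∧ C'.e u = C.e u) ∨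
      (u ∈ A ∧ DoesFirst m C C' u v) ∨ (u ∈ A ∧ DoesSecond m C C' u v) ∨
      (u ∈ A ∧ DoesReset m C C' u v)) := by
  by_cases hu : u ∈ A
  · rcases h.matched_cases hmu hu with hup | ⟨_, ha, hb, hr⟩
    · exact absurd hup.guard (hc hu)
    · exact ⟨ha, hb, by tauto⟩
  · obtain ⟨hp, ha, hb, hs, he⟩ := h.stay_fields hu
    exact ⟨ha, hb, Or.inl ⟨hu, hp, hs, he⟩⟩

theorem not_guardUpdate_of_ppEq (hA : ¬ guardUpdateA G m C u) (hpp : ppEq C u) :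
    ¬ guardUpdate G m C u := by
  obtain ⟨x, hpu, hpx⟩ := hpp
  simp [guardUpdate, hA, hpu, hpx]

/-! ### Locked pairs -/

/-- The first vertex `u` and the second vertex `v` of a matched pair are definitively linked to
the single vertices they ask for. -/
structure Lock (G : SimpleGraph V) (m : V → Option V) (C : MMConfig V) (u v : V) : Prop where
  valid_fst : ¬ guardUpdateA G m C u
  valid_snd : ¬ guardUpdateA G m C v
  ask_fst : askFirst m C u ≠ none
  ask_snd : askSecond m C v ≠ none
  p_fst : C.p u = askFirst m C u
  p_snd : C.p v = askSecond m C v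
  pp_fst : ppEq C u
  pp_snd : ppEq C v
  s_fst : C.s u = true

theorem Trans.lock (h : Trans G m C C' A) (hmu : m u = some v) (hmv : m v = some u)
    (hl : Lock G m C u v) :
    Lock G m C' u v ∧ (C.e v = true → C'.e v = true ∧ (C.e u = true → C'.e u = true)) := by
  obtain ⟨hau, hbu, hu⟩ := h.calm_cases hmu fun _ => not_guardUpdate_of_ppEq hl.valid_fst hl.pp_fst
  obtain ⟨hav, hbv, hv⟩ := h.calm_cases hmv fun _ => not_guardUpdate_of_ppEq hl.valid_snd hl.pp_snd
  have hfu := ask_first_congr hmu hau hbu hav hbv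
  have hsv := ask_second_congr hmv hmu hav hbv hau hbu
  have hfv := ask_first_eq_none_of_second hmv hmu hl.ask_snd
  have hsu : askSecond m C u = none := ask_second_eq_none_of_first hmu hfv
  have hS : mfS m C u v := ⟨hl.p_fst, hl.pp_fst, Or.inl hl.p_snd⟩
  have hE : msE m C v u := ⟨hl.p_snd, hl.pp_snd, hl.p_fst⟩
  have hE' : C.e v = true → mfE m C u v :=
    fun he => ⟨hl.p_fst, hl.pp_fst, hl.s_fst, hl.p_snd, he⟩
  have hu' : C'.p u = C.p u ∧ C'.s u = true ∧
      (C.e v = true → (C.e u = true → C'.e u = true)) := by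
    rcases hu with ⟨_, hp, hs, he⟩ | ⟨_, hd⟩ | ⟨_, hd⟩ | ⟨_, hd⟩
    · exact ⟨hp, hs.trans hl.s_fst, fun _ h => he.trans h⟩
    · exact ⟨hd.p.trans hl.p_fst.symm, hd.s.2 hS, fun hv _ => hd.e.2 (hE' hv)⟩
    · exact absurd hsu hd.ask
    · rcases hd.guard with hg | hg
      · exact absurd hg.1 hl.ask_fst
      · exact absurd hsu hg.1
  have hv' : C'.p v = C.p v ∧ (C.e v = true → C'.e v = true) := by
    rcases hv with ⟨_, hp, _, he⟩ | ⟨_, hd⟩ | ⟨_, hd⟩ | ⟨_, hd⟩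
    · exact ⟨hp, he.trans⟩
    · exact absurd hfv hd.ask
    · exact ⟨hd.p.trans hl.p_snd.symm, fun _ => hd.e.2 hE⟩
    · rcases hd.guard with hg | hg
      · exact absurd hg.2.1 hl.ask_snd
      · exact absurd hl.s_fst (by simp [hg.2.2])
  refine ⟨⟨h.not_guardUpdateA hmu hl.valid_fst, h.not_guardUpdateA hmv hl.valid_snd, ?_, ?_, ?_, ?_,
    h.linked hmu hl.valid_fst hl.pp_fst hu'.1, h.linked hmv hl.valid_snd hl.pp_snd hv'.1, hu'.2.1⟩,
    fun he => ⟨hv'.2 he, hu'.2.2 he⟩⟩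
  · rw [hfu]; exact hl.ask_fst
  · rw [hsv]; exact hl.ask_snd
  · rw [hfu, hu'.1]; exact hl.p_fst
  · rw [hsv, hv'.1]; exact hl.p_snd

/-- The `end` variable of `u` is definitively true. -/
def Final (G : SimpleGraph V) (m : V → Option V) (C : MMConfig V) (u v : V) : Prop :=
  (Lock G m C u v ∧ C.e u = true ∧ C.e v = true) ∨ (Lock G m C v u ∧ C.e u = true)

theorem Trans.final (h : Trans G m C C' A) (hmu : m u = some v) (hmv : m v = some u)
    (hf : Final G m C u v) : Final G m C' u v := by
  rcases hf with ⟨hl, heu, hev⟩ | ⟨hl, heu⟩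
  · obtain ⟨hl', h₁⟩ := h.lock hmu hmv hl
    exact Or.inl ⟨hl', (h₁ hev).2 heu, (h₁ hev).1⟩
  · obtain ⟨hl', h₁⟩ := h.lock hmv hmu hl
    exact Or.inr ⟨hl', (h₁ heu).1⟩

/-- The `end` variable of `u` is true and remains so as long as the partner `v` does not move. -/
def Solid (G : SimpleGraph V) (m : V → Option V) (C : MMConfig V) (u v : V) : Prop :=
  ¬ guardUpdateA G m C u ∧ C.e u = true ∧
    ((askFirst m C u ≠ none ∧ mfE m C u v) ∨
      (askSecond m C u ≠ none ∧ C.s v = true ∧ msE m C u v))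

/-- Establishing `Solid` when the partner does not move: either it held or `u` has just set its
`end` variable. -/
theorem Trans.solid (h : Trans G m C C' A) (hmu : m u = some v) (hmv : m v = some u)
    (hA : ¬ guardUpdateA G m C u) (hv : v ∉ A)
    (ht : (askFirst m C u ≠ none ∧ mfE m C u v) ∨
      (askSecond m C u ≠ none ∧ C.s v = true ∧ msE m C u v))
    (he : C.e u = true ∨ u ∈ A) : Solid G m C' u v := by
  obtain ⟨hpv, hav, hbv, hsv, hev⟩ := h.stay_fields hv
  have hpp : ppEq C u := ht.elim (fun h => h.2.2.1) fun h => h.2.2.2.1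
  obtain ⟨hau, hbu, hu⟩ := h.calm_cases hmu fun _ => not_guardUpdate_of_ppEq hA hpp
  have hfu := ask_first_congr hmu hau hbu hav hbv
  have hfv := ask_first_congr hmv hav hbv hau hbu
  have hgu := ask_second_congr hmu hmv hau hbu hav hbv
  have hgv := ask_second_congr hmv hmu hav hbv hau hbu
  refine ⟨h.not_guardUpdateA hmu hA, ?_⟩
  rcases ht with ⟨hask, hE⟩ | ⟨hask, hs, hE⟩
  · have hS : mfS m C u v := ⟨hE.1, hE.2.1, Or.inl hE.2.2.2.1⟩
    have key : C'.p u = C.p u ∧ C'.s u = true ∧ C'.e u = true := by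
      rcases hu with ⟨hn, hp, hs, hee⟩ | ⟨_, hd⟩ | ⟨_, hd⟩ | ⟨_, hd⟩
      · exact ⟨hp, hs.trans hE.2.2.1, hee.trans (he.resolve_right hn)⟩
      · exact ⟨hd.p.trans hE.1.symm, hd.s.2 hS, hd.e.2 hE⟩
      · exact absurd (ask_first_eq_none_of_second hmu hmv hd.ask) hask
      · rcases hd.guard with hg | hg
        · exact absurd hg.1 hask
        · exact absurd (ask_first_eq_none_of_second hmu hmv hg.1) hask
    refine ⟨key.2.2, Or.inl ⟨by rwa [hfu], ?_, h.linked hmu hA hpp key.1, key.2.1, ?_, ?_⟩⟩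
    · rw [hfu, key.1]; exact hE.1
    · rw [hgv, hpv]; exact hE.2.2.2.1
    · rw [hev]; exact hE.2.2.2.2
  · have hnone := ask_first_eq_none_of_second hmu hmv hask
    have key : C'.p u = C.p u ∧ C'.e u = true := by
      rcases hu with ⟨hn, hp, _, hee⟩ | ⟨_, hd⟩ | ⟨_, hd⟩ | ⟨_, hd⟩
      · exact ⟨hp, hee.trans (he.resolve_right hn)⟩
      · exact absurd hnone hd.ask
      · exact ⟨hd.p.trans hE.1.symm, hd.e.2 hE⟩
      · rcases hd.guard with hg | hg
        · exact absurd hg.2.1 hask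
        · exact absurd hs (by simp [hg.2.2])
    refine ⟨key.2, Or.inr ⟨by rwa [hgu], hsv.trans hs, ?_, h.linked hmu hA hpp key.1, ?_⟩⟩
    · rw [hgu, key.1]; exact hE.1
    · rw [hfv, hpv]; exact hE.2.2

/-! ### Single vertices set `end` to true few times -/

/-- What is known about the matched vertices `S` that have already moved. -/
def MovedInv (G : SimpleGraph V) (m : V → Option V) (C : MMConfig V) (S : Set V) : Prop :=
  ∀ u ∈ S, m u ≠ none → ¬ guardUpdateA G m C u ∧ (C.e u = true → ppEq C u) ∧
    (C.s u = true → ppEq C u)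

theorem Trans.movedInv (h : Trans G m C C' A) {S : Set V} (hI : MovedInv G m C S) :
    MovedInv G m C' (S ∪ A) := by
  intro u hu hne
  obtain ⟨v, hmu⟩ := Option.ne_none_iff_exists'.1 hne
  by_cases huA : u ∈ A
  · refine ⟨h.not_guardUpdateA_of_mem hmu huA, ?_⟩
    rcases h.matched_cases hmu huA with hup | ⟨hnu, _, _, hd | hd | hd⟩
    · simp [hup.s, hup.e]
    · have hA : ¬ guardUpdateA G m C u := fun h => hnu (Or.inl h)
      exact ⟨fun he => h.linked hmu hA (hd.e.1 he).2.1 (hd.p.trans (hd.e.1 he).1.symm),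
        fun hs => h.linked hmu hA (hd.s.1 hs).2.1 (hd.p.trans (hd.s.1 hs).1.symm)⟩
    · have hA : ¬ guardUpdateA G m C u := fun h => hnu (Or.inl h)
      exact ⟨fun he => h.linked hmu hA (hd.e.1 he).2.1 (hd.p.trans (hd.e.1 he).1.symm),
        fun hs => h.linked hmu hA (hd.s.1 hs).2.1 (hd.p.trans (hd.s.1 hs).1.symm)⟩
    · simp [hd.s, hd.e]
  · obtain ⟨hA, he, hs⟩ := hI u (hu.resolve_right huA) hne
    obtain ⟨hp', _, _, hs', he'⟩ := h.stay_fields huA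
    exact ⟨h.not_guardUpdateA hmu hA, fun ht => h.linked hmu hA (he (he' ▸ ht)) hp',
      fun ht => h.linked hmu hA (hs (hs' ▸ ht)) hp'⟩

/-- A matched vertex whose `end` variable is true after a transition keeps its pointer. -/
theorem Trans.p_of_e (h : Trans G m C C' A) (hmu : m u = some v) (he : C'.e u = true) :
    C'.p u = C.p u := by
  by_cases huA : u ∈ A
  · rcases h.matched_cases hmu huA with hup | ⟨_, _, _, hd | hd | hd⟩
    · simp [hup.e] at he
    · exact hd.p.trans (hd.e.1 he).1.symm
    · exact hd.p.trans (hd.e.1 he).1.symm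
    · simp [hd.e] at he
  · exact (h.stay_fields huA).1

/-- A matched vertex setting its `end` variable to true executes a match rule. -/
theorem Trans.target_of_flip (h : Trans G m C C' A) (hmu : m u = some v) (he : C.e u = false)
    (he' : C'.e u = true) : u ∈ A ∧ ¬ guardUpdateA G m C u ∧
      ((askFirst m C u ≠ none ∧ mfE m C u v) ∨
      (askSecond m C u ≠ none ∧ C.s v = true ∧ msE m C u v)) := by
  by_cases huA : u ∈ A
  · rcases h.matched_cases hmu huA with hup | ⟨hnu, _, _, hd | hd | hd⟩
    · simp [hup.e] at he'
    · exact ⟨huA, fun h => hnu (Or.inl h), Or.inl ⟨hd.ask, hd.e.1 he'⟩⟩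
    · exact ⟨huA, fun h => hnu (Or.inl h), Or.inr ⟨hd.ask, hd.partner, hd.e.1 he'⟩⟩
    · simp [hd.e] at he'
  · simp [(h.stay_fields huA).2.2.2.2, he] at he'

/-- `u` is linked to a single neighbour whose `end` variable is true. -/
def EndLinked (G : SimpleGraph V) (m : V → Option V) (C : MMConfig V) (u : V) : Prop :=
  ∃ x, G.Adj u x ∧ m x = none ∧ C.p u = some x ∧ C.p x = some u ∧ C.e x = true

/-- The single vertex `x`, linked to `u`, sets its `end` variable to true. -/
def EndWrite (G : SimpleGraph V) (m : V → Option V) (C C' : MMConfig V) (u x : V) : Prop :=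
  G.Adj u x ∧ m x = none ∧ C.p u = some x ∧ C.p x = some u ∧ C.e u = true ∧ C.e x = false ∧
    C'.e x = true

theorem Trans.endLinked (h : Trans G m C C' A) (hmu : m u = some v) (he : C.e u = true)
    (hl : EndLinked G m C u) (hp : C'.p u = C.p u) : EndLinked G m C' u := by
  obtain ⟨x, hadj, hmx, hpu, hpx, hex⟩ := hl
  rcases h.single_cases hmx with hc | hc | hc | hc
  · exact ⟨x, hadj, hmx, hp.trans hpu, hc.1.trans hpx, hc.2.trans hex⟩
  · simp [hpx] at hc
  · have := hc.1
    simp [guardUpdateP, hpx, hpu, hadj.symm, hmu] at this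
  · obtain ⟨hpx', w, hw, _, _, _, hc⟩ := hc
    obtain rfl : u = w := Option.some_inj.1 (hpx.symm.trans hw)
    exact ⟨x, hadj, hmx, hp.trans hpu, hpx'.trans hpx, hc.trans he⟩

theorem Trans.endLinked_of_write (h : Trans G m C C' A) (hw : EndWrite G m C C' u x)
    (hp : C'.p u = C.p u) : EndLinked G m C' u := by
  obtain ⟨hadj, hmx, hpu, hpx, heu, hex, hex'⟩ := hw
  rcases h.single_cases hmx with hc | hc | hc | hc
  · simp [hc.2, hex] at hex'
  · simp [hpx] at hc
  · simp [hc.2] at hex'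
  · exact ⟨x, hadj, hmx, hp.trans hpu, hc.1.trans hpx, hex'⟩

/-- Bound on the number of times `u` may still change its `end` variable to true, where `S` is
the set of vertices that have already moved. -/
noncomputable def flips (G : SimpleGraph V) (m : V → Option V) (C : MMConfig V) (S : Set V)
    (u v : V) : ℕ :=
  if Final G m C u v then 0 else if v ∈ S then 1 else if Solid G m C u v then 1 else 2

theorem flips_le (S : Set V) : flips G m C S u v ≤ 2 := by
  unfold flips
  split_ifs <;> simp

theorem Trans.flips_step (h : Trans G m C C' A) (hmu : m u = some v) (hmv : m v = some u)
    (S : Set V) : flips G m C' (S ∪ A) u v ≤ flips G m C S u v := by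
  unfold flips
  by_cases hF : Final G m C u v
  · simp [h.final hmu hmv hF, hF]
  by_cases hv : v ∈ S
  · simp only [hF, hv, Set.mem_union, true_or, if_true, if_false]
    split_ifs <;> simp
  by_cases hS : Solid G m C u v
  · by_cases hvA : v ∈ A
    · simp only [hF, hv, hS, hvA, Set.mem_union, or_true, if_true, if_false]
      split_ifs <;> simp
    · have := h.solid hmu hmv hS.1 hvA hS.2.2 (Or.inl hS.2.1)
      simp only [hF, hv, hS, hvA, this, Set.mem_union, if_true, if_false]
      split_ifs <;> simp
  · simp only [hF, hv, hS, if_false]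
    split_ifs <;> simp

theorem Trans.flips_step_of_flip (h : Trans G m C C' A) (hmu : m u = some v) (hmv : m v = some u)
    {S : Set V} (hI : MovedInv G m C S) (he : C.e u = false) (he' : C'.e u = true) :
    flips G m C' (S ∪ A) u v + 1 ≤ flips G m C S u v := by
  have hF : ¬ Final G m C u v := by simp [Final, he]
  have hS : ¬ Solid G m C u v := by simp [Solid, he]
  obtain ⟨huA, hA, ht⟩ := h.target_of_flip hmu he he'
  unfold flips
  by_cases hv : v ∈ S
  · have hF' : Final G m C' u v := by
      obtain ⟨hAv, hev, hsv⟩ := hI v hv (by simp [hmv])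
      rcases ht with ⟨hask, hE⟩ | ⟨hask, hs, hE⟩
      · obtain ⟨y, hy, _⟩ := hev hE.2.2.2.2
        have hl : Lock G m C u v := ⟨hA, hAv, hask, by simp [← hE.2.2.2.1, hy], hE.1,
          hE.2.2.2.1, hE.2.1, hev hE.2.2.2.2, hE.2.2.1⟩
        obtain ⟨hl', h₁⟩ := h.lock hmu hmv hl
        exact Or.inl ⟨hl', he', (h₁ hE.2.2.2.2).1⟩
      · have hl : Lock G m C v u := ⟨hAv, hA, ask_first_partner hmu hask, hask, hE.2.2, hE.1,
          hsv hs, hE.2.1, hs⟩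
        exact Or.inr ⟨(h.lock hmv hmu hl).1, he'⟩
    simp [hF, hv, hF']
  · simp only [hF, hS, hv, if_false]
    by_cases hvA : v ∈ A
    · simp only [hvA, Set.mem_union, or_true, if_true]
      split_ifs <;> simp
    · have := h.solid hmu hmv hA hvA ht (Or.inr huA)
      simp only [this, if_true]
      split_ifs <;> simp

/-- Bound on the number of times a single vertex may still set its `end` variable to true by
copying that of `u`. -/
noncomputable def writes (G : SimpleGraph V) (m : V → Option V) (C : MMConfig V) (S : Set V)
    (u v : V) : ℕ :=
  ind (C.e u = true ∧ ¬ EndLinked G m C u) + flips G m C S u v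

theorem writes_le (S : Set V) : writes G m C S u v ≤ 3 := by
  have h₁ := ind_le_one (C.e u = true ∧ ¬ EndLinked G m C u)
  have h₂ := flips_le (G := G) (m := m) (C := C) (u := u) (v := v) S
  unfold writes
  omega

theorem Trans.writes_step (h : Trans G m C C' A) (hmu : m u = some v) (hmv : m v = some u)
    {S : Set V} (hI : MovedInv G m C S) :
    ind (∃ x, EndWrite G m C C' u x) + writes G m C' (S ∪ A) u v ≤ writes G m C S u v := by
  unfold writes
  by_cases hflip : C.e u = false ∧ C'.e u = true
  · have h₁ := h.flips_step_of_flip hmu hmv hI hflip.1 hflip.2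
    have h₂ : ind (∃ x, EndWrite G m C C' u x) = 0 := ind_neg (by simp [EndWrite, hflip.1])
    have h₃ := ind_le_one (C'.e u = true ∧ ¬ EndLinked G m C' u)
    omega
  · have h₁ := h.flips_step hmu hmv S
    suffices h₂ : ind (∃ x, EndWrite G m C C' u x) + ind (C'.e u = true ∧ ¬ EndLinked G m C' u) ≤
        ind (C.e u = true ∧ ¬ EndLinked G m C u) by omega
    by_cases hw : ∃ x, EndWrite G m C C' u x
    · obtain ⟨x, hx⟩ := hw
      have h₃ : ¬ (C'.e u = true ∧ ¬ EndLinked G m C' u) := fun h' =>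
        h'.2 (h.endLinked_of_write hx (h.p_of_e hmu h'.1))
      have h₄ : C.e u = true ∧ ¬ EndLinked G m C u := by
        refine ⟨hx.2.2.2.2.1, ?_⟩
        rintro ⟨y, _, _, hy, _, hy'⟩
        obtain rfl : x = y := Option.some_inj.1 (hx.2.2.1.symm.trans hy)
        simp [hx.2.2.2.2.2.1] at hy'
      rw [ind_neg h₃, ind_pos h₄]
      exact ind_le_one _
    · rw [ind_neg hw, zero_add]
      refine ind_mono fun ⟨he', hl'⟩ => ?_
      have he : C.e u = true := by
        by_contra hc
        exact hflip ⟨by simpa using hc, he'⟩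
      exact ⟨he, fun hl => hl' (h.endLinked hmu he hl (h.p_of_e hmu he'))⟩

/-- A single vertex setting its `end` variable to true copies that of the vertex it is linked to. -/
theorem Trans.exists_endWrite (h : Trans G m C C' A) (hmx : m x = none) (he : C.e x = false)
    (he' : C'.e x = true) : ∃ u, m u ≠ none ∧ EndWrite G m C C' u x := by
  rcases h.single_cases hmx with hc | hc | hc | hc
  · simp [hc.2, he] at he'
  · simp [hc.2.2] at he'
  · simp [hc.2] at he'
  · obtain ⟨_, w, hw, hadj, hmw, hpw, hc⟩ := hc
    exact ⟨w, hmw, hadj.symm, hmx, hpw, hw, hc.symm.trans he', he, he'⟩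

/-! ### Moves of a matched pair between two executions of `Update` -/

/-- Bound on the number of changes of `s` at the first vertex `u` of a pair. -/
noncomputable def sChanges (G : SimpleGraph V) (m : V → Option V) (C : MMConfig V) (u v : V) : ℕ :=
  if guardUpdateA G m C u then 0
  else if mfS m C u v then ind (C.s u = false) else 1 + ind (C.s u = true)

/-- Condition of `MatchSecond`, once `u` is second and `s` is true at its partner `v`. -/
def SecondPending (m : V → Option V) (C : MMConfig V) (u v : V) : Prop :=
  C.p u ≠ askSecond m C u ∨ ¬ (C.e u = true ↔ msE m C u v) ∨ C.s u ≠ C.e u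

/-- Condition of `MatchFirst`, once `u` is first. -/
def FirstPending (m : V → Option V) (C : MMConfig V) (u v : V) : Prop :=
  C.p u ≠ askFirst m C u ∨ ¬ (C.s u = true ↔ mfS m C u v) ∨ ¬ (C.e u = true ↔ mfE m C u v)

/-- Bound on the number of moves of the second vertex `u` of a pair while `s` is unchanged at the
first vertex `v`. -/
noncomputable def secondMoves (m : V → Option V) (C : MMConfig V) (u v : V) : ℕ :=
  if C.s v = true then ind (¬ msE m C u v) + ind (SecondPending m C u v) else ind (C.p u ≠ none)

/-- Bound on the number of moves of a vertex `u` which is not first, with partner `v`, before the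
next `Update` in the pair. -/
noncomputable def otherMoves (G : SimpleGraph V) (m : V → Option V) (C : MMConfig V) (u v : V) :
    ℕ :=
  if guardUpdateA G m C u then 0
  else if askSecond m C u ≠ none then secondMoves m C u v + 2 * sChanges G m C v u
  else ind (¬ (C.p u = none ∧ C.s u = false ∧ C.e u = false))

/-- Bound on the number of moves of a vertex `u` which is first, with partner `v`, before the next
`Update` in the pair. -/
noncomputable def firstMoves (G : SimpleGraph V) (m : V → Option V) (C : MMConfig V) (u v : V) :
    ℕ :=
  ind (FirstPending m C u v) +
    if askFirst m C v = none then
      ind (¬ (C.p u = askFirst m C u ∧ ppEq C u)) + sChanges G m C u v + otherMoves G m C v u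
    else if C.p v = none then
      ind (¬ (C.p u = askFirst m C u ∧ ppEq C u)) + sChanges G m C u v + 1
    else 0

/-- Bound on the number of moves of `u`, with partner `v`, before the next `Update` in the pair. -/
noncomputable def moveBound (G : SimpleGraph V) (m : V → Option V) (C : MMConfig V) (u v : V) : ℕ :=
  if guardUpdateA G m C u then 0
  else if askFirst m C u ≠ none then firstMoves G m C u v else otherMoves G m C u v

theorem sChanges_le : sChanges G m C u v ≤ 2 := by
  have h₁ := ind_le_one (C.s u = true)
  have h₂ := ind_le_one (C.s u = false)
  unfold sChanges
  split_ifs <;> omega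

theorem secondMoves_le : secondMoves m C u v ≤ 2 := by
  have h₁ := ind_le_one (¬ msE m C u v)
  have h₂ := ind_le_one (SecondPending m C u v)
  have h₃ := ind_le_one (C.p u ≠ none)
  unfold secondMoves
  split_ifs <;> omega

theorem otherMoves_le : otherMoves G m C u v ≤ 6 := by
  have h₁ := sChanges_le (G := G) (m := m) (C := C) (u := v) (v := u)
  have h₂ := secondMoves_le (m := m) (C := C) (u := u) (v := v)
  have h₃ := ind_le_one (¬ (C.p u = none ∧ C.s u = false ∧ C.e u = false))
  unfold otherMoves
  split_ifs <;> omega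

theorem moveBound_le : moveBound G m C u v ≤ 10 := by
  have h₁ := ind_le_one (FirstPending m C u v)
  have h₂ := ind_le_one (¬ (C.p u = askFirst m C u ∧ ppEq C u))
  have h₃ := sChanges_le (G := G) (m := m) (C := C) (u := u) (v := v)
  have h₄ := otherMoves_le (G := G) (m := m) (C := C) (u := v) (v := u)
  have h₅ := otherMoves_le (G := G) (m := m) (C := C) (u := u) (v := v)
  unfold moveBound firstMoves
  split_ifs <;> omega

/-- A transition in which neither `u` nor its partner `v` executes `Update`. -/
structure Calm (G : SimpleGraph V) (m : V → Option V) (C C' : MMConfig V) (A : Set V) (u v : V) :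
    Prop where
  trans : Trans G m C C' A
  fst : m u = some v
  snd : m v = some u
  calm_fst : u ∈ A → ¬ guardUpdate G m C u
  calm_snd : v ∈ A → ¬ guardUpdate G m C v

namespace Calm

theorem symm (h : Calm G m C C' A u v) : Calm G m C C' A v u :=
  ⟨h.trans, h.snd, h.fst, h.calm_snd, h.calm_fst⟩

theorem askFirst_eq (h : Calm G m C C' A u v) : askFirst m C' u = askFirst m C u := by
  obtain ⟨hau, hbu, _⟩ := h.trans.calm_cases h.fst h.calm_fst
  obtain ⟨hav, hbv, _⟩ := h.trans.calm_cases h.snd h.calm_snd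
  exact ask_first_congr h.fst hau hbu hav hbv

theorem askSecond_eq (h : Calm G m C C' A u v) : askSecond m C' u = askSecond m C u := by
  obtain ⟨hau, hbu, _⟩ := h.trans.calm_cases h.fst h.calm_fst
  obtain ⟨hav, hbv, _⟩ := h.trans.calm_cases h.snd h.calm_snd
  exact ask_second_congr h.fst h.snd hau hbu hav hbv

theorem guardUpdateA_iff (h : Calm G m C C' A u v) :
    guardUpdateA G m C' u ↔ guardUpdateA G m C u := by
  refine ⟨fun hg => by_contra fun hc => h.trans.not_guardUpdateA h.fst hc hg, fun hg => ?_⟩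
  have hu : u ∉ A := fun hu => h.calm_fst hu (Or.inl hg)
  obtain ⟨hp, ha, hb, _⟩ := h.trans.stay_fields hu
  unfold guardUpdateA at hg ⊢
  rwa [hp, ha, hb]

theorem not_mem (h : Calm G m C C' A u v) (hg : guardUpdateA G m C u) : u ∉ A :=
  fun hu => h.calm_fst hu (Or.inl hg)

/-- The possible evolutions of a vertex which is first. -/
theorem first_cases (h : Calm G m C C' A u v) (hf : askFirst m C u ≠ none) :
    (u ∉ A ∧ C'.p u = C.p u ∧ C'.s u = C.s u ∧ C'.e u = C.e u) ∨
    (u ∈ A ∧ DoesFirst m C C' u v) := by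
  obtain ⟨_, _, hu⟩ := h.trans.calm_cases h.fst h.calm_fst
  rcases hu with hu | hu | ⟨_, hd⟩ | ⟨_, hd⟩
  · exact Or.inl hu
  · exact Or.inr hu
  · exact absurd (ask_first_eq_none_of_second h.fst h.snd hd.ask) hf
  · rcases hd.guard with hg | hg
    · exact absurd hg.1 hf
    · exact absurd (ask_first_eq_none_of_second h.fst h.snd hg.1) hf

/-- The possible evolutions of a vertex which is not first. -/
theorem other_cases (h : Calm G m C C' A u v) (hf : askFirst m C u = none) :
    (u ∉ A ∧ C'.p u = C.p u ∧ C'.s u = C.s u ∧ C'.e u = C.e u) ∨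
    (u ∈ A ∧ DoesSecond m C C' u v) ∨ (u ∈ A ∧ DoesReset m C C' u v) := by
  obtain ⟨_, _, hu⟩ := h.trans.calm_cases h.fst h.calm_fst
  rcases hu with hu | ⟨_, hd⟩ | hu | hu
  · exact Or.inl hu
  · exact absurd hf hd.ask
  · exact Or.inr (Or.inl hu)
  · exact Or.inr (Or.inr hu)

theorem linked_first (h : Calm G m C C' A u v) (hf : askFirst m C u ≠ none)
    (hA : ¬ guardUpdateA G m C u) (hp : C.p u = askFirst m C u ∧ ppEq C u) :
    C'.p u = askFirst m C' u ∧ ppEq C' u := by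
  have hpu : C'.p u = C.p u := by
    rcases h.first_cases hf with hu | ⟨_, hd⟩
    · exact hu.2.1
    · exact hd.p.trans hp.1.symm
  exact ⟨by rw [h.askFirst_eq, hpu, hp.1], h.trans.linked h.fst hA hp.2 hpu⟩

/-- While the partner keeps its pointer admissible, `s` changes at the first vertex only when
`sChanges` decreases. -/
theorem sChanges_step (h : Calm G m C C' A u v) (hf : askFirst m C u ≠ none)
    (hR : C.p v = askSecond m C v ∨ C.p v = none → C'.p v = askSecond m C' v ∨ C'.p v = none) :
    sChanges G m C' u v ≤ sChanges G m C u v ∧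
      (C'.s u ≠ C.s u → sChanges G m C' u v + 1 ≤ sChanges G m C u v) := by
  unfold sChanges
  rw [h.guardUpdateA_iff]
  by_cases hA : guardUpdateA G m C u
  · simp [hA, h.trans.stay_fields (h.not_mem hA)]
  have hmono : mfS m C u v → mfS m C' u v := fun hS =>
    have hl := h.linked_first hf hA ⟨hS.1, hS.2.1⟩
    ⟨hl.1, hl.2, hR hS.2.2⟩
  simp only [hA, if_false]
  rcases h.first_cases hf with ⟨_, _, hs, _⟩ | ⟨_, hd⟩
  · rw [hs]
    refine ⟨?_, fun hc => absurd rfl hc⟩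
    cases C.s u <;> simp only [ind] <;> split_ifs <;> simp_all
  · have hs := hd.s
    clear hd hR
    generalize mfS m C u v = P, mfS m C' u v = P', C.s u = b, C'.s u = b' at hs hmono ⊢
    by_cases hP : P <;> by_cases hP' : P' <;> cases b <;> cases b' <;> simp_all [ind]

/-- The pointer of a vertex which is not first stays admissible. -/
theorem admissible (h : Calm G m C C' A u v) (hf : askFirst m C u = none)
    (hp : C.p u = askSecond m C u ∨ C.p u = none) :
    C'.p u = askSecond m C' u ∨ C'.p u = none := by
  rw [h.askSecond_eq]
  rcases h.other_cases hf with hu | ⟨_, hd⟩ | ⟨_, hd⟩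
  · rwa [hu.2.1]
  · exact Or.inl hd.p
  · exact Or.inr hd.p

theorem secondMoves_step (h : Calm G m C C' A u v) (hA : ¬ guardUpdateA G m C u)
    (hg : askSecond m C u ≠ none) (hs : C'.s v = C.s v) :
    ind (u ∈ A) + secondMoves m C' u v ≤ secondMoves m C u v := by
  have hf := ask_first_eq_none_of_second h.fst h.snd hg
  have hfv := ask_first_partner h.fst hg
  unfold secondMoves
  rw [hs]
  by_cases hsv : C.s v = true
  · simp only [hsv, if_true]
    have hpv : C.p v = askFirst m C v → C'.p v = askFirst m C' v := fun hp => by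
      rw [h.symm.askFirst_eq]
      rcases h.symm.first_cases hfv with hv | ⟨_, hd⟩
      · rw [hv.2.1, hp]
      · exact hd.p
    rcases h.other_cases hf with ⟨hu, hp, hs', he⟩ | ⟨hu, hd⟩ | ⟨_, hd⟩
    · have hmono : msE m C u v → msE m C' u v := fun hE =>
        ⟨by rw [h.askSecond_eq, hp, hE.1], h.trans.linked h.fst hA hE.2.1 hp, hpv hE.2.2⟩
      have hpend : (msE m C' u v ↔ msE m C u v) →
          SecondPending m C' u v → SecondPending m C u v := fun hiff hP => by
        unfold SecondPending at hP ⊢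
        rwa [hp, hs', he, h.askSecond_eq, hiff] at hP
      have h₁ := ind_le_one (SecondPending m C' u v)
      rw [ind_neg hu]
      by_cases hE' : msE m C' u v
      · by_cases hE : msE m C u v
        · have := ind_mono (hpend (by simp [hE, hE']))
          simp only [ind, hE, hE', not_true_eq_false, if_false] at this ⊢
          omega
        · simp only [ind, hE, hE', not_true_eq_false, not_false_eq_true, if_false, if_true] at h₁ ⊢
          omega
      · have hE : ¬ msE m C u v := fun hE => hE' (hmono hE)
        have := ind_mono (hpend (by simp [hE, hE']))
        simp only [ind, hE, hE', not_false_eq_true, if_true] at this ⊢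
        omega
    · have hmono : msE m C u v → msE m C' u v := fun hE =>
        ⟨by rw [h.askSecond_eq, hd.p], h.trans.linked h.fst hA hE.2.1 (hd.p.trans hE.1.symm),
          hpv hE.2.2⟩
      have hpend : SecondPending m C u v := hd.guard
      have hdone : (msE m C' u v ↔ msE m C u v) → ¬ SecondPending m C' u v := fun hiff => by
        have hse : C'.s u = C'.e u := by
          have := hd.s.trans hd.e.symm
          cases h₁ : C'.s u <;> cases h₂ : C'.e u <;> simp_all
        simp [SecondPending, h.askSecond_eq, hd.p, hiff, hd.e, hse]
      have h₁ := ind_le_one (SecondPending m C' u v)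
      rw [ind_pos hu, ind_pos hpend]
      by_cases hE' : msE m C' u v
      · by_cases hE : msE m C u v
        · rw [ind_neg (hdone (by simp [hE, hE'])), ind_neg (not_not.2 hE')]
          omega
        · rw [ind_neg (not_not.2 hE'), ind_pos hE]
          omega
      · have hE : ¬ msE m C u v := fun hE => hE' (hmono hE)
        rw [ind_neg (hdone (by simp [hE, hE'])), ind_pos hE, ind_pos hE']
    · rcases hd.guard with hg' | hg'
      · exact absurd hg'.2.1 hg
      · simp [hsv] at hg'
  · rw [if_neg hsv, if_neg hsv]
    rcases h.other_cases hf with ⟨hu, hp, _⟩ | ⟨_, hd⟩ | ⟨hu, hd⟩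
    · simp [ind_neg hu, hp]
    · exact absurd hd.partner hsv
    · rcases hd.guard with hg' | hg'
      · exact absurd hg'.2.1 hg
      · rw [ind_pos hu, ind_pos hg'.2.1, ind_neg (by simp [hd.p])]

theorem secondMoves_pos (h : Calm G m C C' A u v) (hg : askSecond m C u ≠ none) :
    ind (u ∈ A) ≤ secondMoves m C u v := by
  have hf := ask_first_eq_none_of_second h.fst h.snd hg
  unfold secondMoves
  rcases h.other_cases hf with ⟨hu, _⟩ | ⟨_, hd⟩ | ⟨_, hd⟩
  · simp [ind_neg hu]
  · have hP : SecondPending m C u v := hd.guard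
    rw [if_pos hd.partner, ind_pos hP]
    exact (ind_le_one _).trans (Nat.le_add_left _ _)
  · rcases hd.guard with hg' | hg'
    · exact absurd hg'.2.1 hg
    · rw [if_neg (by simp [hg'.2.2]), ind_pos hg'.2.1]
      exact ind_le_one _

theorem otherMoves_step (h : Calm G m C C' A u v) (hf : askFirst m C u = none) :
    ind (u ∈ A) + otherMoves G m C' u v ≤ otherMoves G m C u v := by
  unfold otherMoves
  rw [h.guardUpdateA_iff, h.askSecond_eq]
  by_cases hA : guardUpdateA G m C u
  · simp [hA, ind_neg (h.not_mem hA)]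
  by_cases hg : askSecond m C u = none
  · simp only [hA, hg, ne_eq, not_true_eq_false, if_false]
    rcases h.other_cases hf with ⟨hu, hp, hs, he⟩ | ⟨_, hd⟩ | ⟨hu, hd⟩
    · rw [ind_neg hu, hp, hs, he, zero_add]
    · exact absurd hg hd.ask
    · rcases hd.guard with hg' | hg'
      · rw [ind_pos hu, ind_pos hg'.2.2, hd.p, hd.s, hd.e]
        simp [ind]
      · exact absurd hg hg'.1
  · simp only [hA, hg, ne_eq, not_false_eq_true, if_true, if_false]
    have hfv := ask_first_partner h.fst hg
    obtain ⟨h₁, h₂⟩ := h.symm.sChanges_step hfv (h.admissible hf)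
    by_cases hs : C'.s v = C.s v
    · have := h.secondMoves_step hA hg hs
      omega
    · have h₃ := h₂ hs
      have h₄ := h.secondMoves_pos hg
      have h₅ := secondMoves_le (m := m) (C := C') (u := u) (v := v)
      omega

/-- If nothing that `MatchFirst` reads changes, a first vertex is pending only if it was pending
and did not move. -/
theorem firstPending_step (h : Calm G m C C' A u v) (hf : askFirst m C u ≠ none)
    (hS : mfS m C' u v ↔ mfS m C u v) (hE : mfE m C' u v ↔ mfE m C u v) :
    ind (u ∈ A) + ind (FirstPending m C' u v) ≤ ind (FirstPending m C u v) := by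
  rcases h.first_cases hf with ⟨hu, hp, hs, he⟩ | ⟨hu, hd⟩
  · rw [ind_neg hu, zero_add]
    refine ind_mono fun hP => ?_
    unfold FirstPending at hP ⊢
    rwa [hp, hs, he, h.askFirst_eq, hS, hE] at hP
  · have hP : FirstPending m C u v := hd.guard
    have hP' : ¬ FirstPending m C' u v := by
      simp [FirstPending, h.askFirst_eq, hd.p, hS, hE, hd.s, hd.e]
    rw [ind_pos hu, ind_pos hP, ind_neg hP']

theorem mem_le_firstPending (h : Calm G m C C' A u v) (hf : askFirst m C u ≠ none) :
    ind (u ∈ A) ≤ ind (FirstPending m C u v) := by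
  refine ind_mono fun hu => ?_
  rcases h.first_cases hf with ⟨hu', _⟩ | ⟨_, hd⟩
  · exact absurd hu hu'
  · exact hd.guard

theorem firstMoves_step (h : Calm G m C C' A u v) (hA : ¬ guardUpdateA G m C u)
    (hf : askFirst m C u ≠ none) :
    ind (u ∈ A) + firstMoves G m C' u v ≤ firstMoves G m C u v := by
  have hmem := h.mem_le_firstPending hf
  have hle := ind_le_one (FirstPending m C' u v)
  have hlink := ind_mono (mt (h.linked_first hf hA))
  have hlink' : ¬ ((C'.p u = askFirst m C' u ∧ ppEq C' u) ↔ (C.p u = askFirst m C u ∧ ppEq C u)) →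
      ind (¬ (C'.p u = askFirst m C' u ∧ ppEq C' u)) + 1 ≤
        ind (¬ (C.p u = askFirst m C u ∧ ppEq C u)) := fun hne => by
    have h₁ : ¬ (C.p u = askFirst m C u ∧ ppEq C u) := fun hc =>
      hne (iff_of_true (h.linked_first hf hA hc) hc)
    have h₂ : C'.p u = askFirst m C' u ∧ ppEq C' u := by_contra fun hc => hne (iff_of_false hc h₁)
    rw [ind_pos h₁, ind_neg (not_not.2 h₂)]
  have hpend : ((C'.p u = askFirst m C' u ∧ ppEq C' u) ↔ (C.p u = askFirst m C u ∧ ppEq C u)) →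
      C'.s u = C.s u → v ∉ A →
      ind (u ∈ A) + ind (FirstPending m C' u v) ≤ ind (FirstPending m C u v) := fun h₁ h₂ h₃ => by
    obtain ⟨hpv, _, _, _, hev⟩ := h.trans.stay_fields h₃
    refine h.firstPending_step hf ?_ ?_
    · simp only [mfS, ← and_assoc]
      rw [h₁, hpv, h.symm.askSecond_eq]
    · simp only [mfE, ← and_assoc]
      rw [h₁, hpv, h.symm.askSecond_eq, h₂, hev]
  unfold firstMoves
  rw [h.symm.askFirst_eq]
  by_cases hfv : askFirst m C v = none
  · simp only [hfv, if_true]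
    have h₁ := h.symm.otherMoves_step hfv
    obtain ⟨h₂, h₃⟩ := h.sChanges_step hf (h.symm.admissible hfv)
    by_cases hv : v ∈ A
    · rw [ind_pos hv] at h₁
      omega
    rw [ind_neg hv] at h₁
    by_cases hs : C'.s u = C.s u
    · by_cases hl : (C'.p u = askFirst m C' u ∧ ppEq C' u) ↔ (C.p u = askFirst m C u ∧ ppEq C u)
      · have := hpend hl hs hv
        omega
      · have := hlink' hl
        omega
    · have := h₃ hs
      omega
  · simp only [hfv, if_false]
    by_cases hpv : C.p v = none
    · simp only [hpv, if_true]
      by_cases hv : v ∈ A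
      · rcases h.symm.first_cases hfv with ⟨hv', _⟩ | ⟨_, hd⟩
        · exact absurd hv hv'
        · rw [if_neg (by rwa [hd.p])]
          omega
      · have hpv' := (h.trans.stay_fields hv).1.trans hpv
        rw [if_pos hpv']
        obtain ⟨h₂, h₃⟩ := h.sChanges_step hf fun _ => Or.inr hpv'
        by_cases hs : C'.s u = C.s u
        · by_cases hl : (C'.p u = askFirst m C' u ∧ ppEq C' u) ↔
            (C.p u = askFirst m C u ∧ ppEq C u)
          · have := hpend hl hs hv
            omega
          · have := hlink' hl
            omega
        · have := h₃ hs
          omega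
    · have hg : askSecond m C v = none := ask_second_eq_none_of_both h.snd h.fst hfv hf
      have hpv' : C'.p v ≠ none := by
        rcases h.symm.first_cases hfv with ⟨_, hp, _⟩ | ⟨_, hd⟩
        · rwa [hp]
        · rwa [hd.p]
      simp only [hpv, hpv', if_false, add_zero]
      refine h.firstPending_step hf ?_ ?_
      · simp [mfS, h.symm.askSecond_eq, hg, hpv, hpv']
      · simp [mfE, h.symm.askSecond_eq, hg, hpv, hpv']

theorem moveBound_step (h : Calm G m C C' A u v) :
    ind (u ∈ A) + moveBound G m C' u v ≤ moveBound G m C u v := by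
  unfold moveBound
  rw [h.guardUpdateA_iff, h.askFirst_eq]
  by_cases hA : guardUpdateA G m C u
  · simp [hA, ind_neg (h.not_mem hA)]
  by_cases hf : askFirst m C u = none
  · simpa [hA, hf] using h.otherMoves_step hf
  · simpa [hA, hf] using h.firstMoves_step hA hf

end Calm

theorem Trans.moveBound_step (h : Trans G m C C' A) (hmu : m u = some v) (hmv : m v = some u) :
    ind (u ∈ A) + moveBound G m C' u v ≤ moveBound G m C u v +
      11 * (ind (u ∈ A ∧ guardUpdate G m C u) + ind (v ∈ A ∧ guardUpdate G m C v)) := by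
  by_cases h₁ : u ∈ A ∧ guardUpdate G m C u
  · have h₂ := ind_le_one (u ∈ A)
    have h₃ := moveBound_le (G := G) (m := m) (C := C') (u := u) (v := v)
    rw [ind_pos h₁]
    omega
  by_cases h₂ : v ∈ A ∧ guardUpdate G m C v
  · have h₂' := ind_le_one (u ∈ A)
    have h₃ := moveBound_le (G := G) (m := m) (C := C') (u := u) (v := v)
    rw [ind_pos h₂]
    omega
  have hc : Calm G m C C' A u v :=
    ⟨h, hmu, hmv, fun hu hg => h₁ ⟨hu, hg⟩, fun hv hg => h₂ ⟨hv, hg⟩⟩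
  exact le_add_right hc.moveBound_step

/-! ### Global potentials -/

/-- The matched vertices. -/
noncomputable def matchedSet (m : V → Option V) : Finset V :=
  Finset.univ.filter fun u : V => m u ≠ none

/-- The partner of a matched vertex. -/
def partner (m : V → Option V) (u : V) : V := (m u).getD u

theorem partner_spec (hm : MaxMatchingOn G m) (hu : u ∈ matchedSet m) :
    m u = some (partner m u) ∧ m (partner m u) = some u := by
  have hne : m u ≠ none := by simpa [matchedSet] using hu
  obtain ⟨v, hv⟩ := Option.ne_none_iff_exists'.1 hne
  have : partner m u = v := by simp [partner, hv]
  rw [this]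
  exact ⟨hv, hm.symm u v hv⟩

theorem sum_partner (hm : MaxMatchingOn G m) (f : V → ℕ) :
    ∑ u ∈ matchedSet m, f (partner m u) = ∑ u ∈ matchedSet m, f u := by
  have hmem : ∀ u ∈ matchedSet m, partner m u ∈ matchedSet m := fun u hu => by
    simp [matchedSet, (partner_spec hm hu).2]
  have hinv : ∀ u ∈ matchedSet m, partner m (partner m u) = u := fun u hu => by
    rw [partner, (partner_spec hm hu).2, Option.getD_some]
  exact Finset.sum_nbij' (partner m) (partner m) hmem hmem hinv hinv fun _ _ => rfl

/-- Bound on the number of changes of `end` variables at single vertices. -/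
noncomputable def endPotential (G : SimpleGraph V) (m : V → Option V) (C : MMConfig V)
    (S : Set V) : ℕ :=
  2 * ∑ u ∈ matchedSet m, writes G m C S u (partner m u) + ∑ x, ind (m x = none ∧ C.e x = true)

theorem sum_endWrite_le (u : V) :
    ∑ x, ind (EndWrite G m C C' u x) ≤ ind (∃ x, EndWrite G m C C' u x) := by
  by_cases h : ∃ x, EndWrite G m C C' u x
  · obtain ⟨x, hx⟩ := h
    rw [Finset.sum_eq_single x]
    · exact ind_mono fun h => ⟨x, h⟩
    · exact fun y _ hy => ind_neg fun hy' =>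
        hy (Option.some_inj.1 (hy'.2.2.1.symm.trans hx.2.2.1))
    · simp
  · rw [Finset.sum_eq_zero fun x _ => ind_neg fun hx => h ⟨x, hx⟩]
    exact Nat.zero_le _

theorem Trans.endPotential_step (h : Trans G m C C' A) (hm : MaxMatchingOn G m) {S : Set V}
    (hI : MovedInv G m C S) :
    ∑ x, ind (m x = none ∧ C'.e x ≠ C.e x) + endPotential G m C' (S ∪ A) ≤
      endPotential G m C S := by
  have hx : ∀ x ∈ Finset.univ, ind (m x = none ∧ C'.e x ≠ C.e x) + ind (m x = none ∧ C'.e x = true)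
      ≤ ind (m x = none ∧ C.e x = true) +
        2 * ∑ u ∈ matchedSet m, ind (EndWrite G m C C' u x) := by
    intro x _
    by_cases hmx : m x = none
    · by_cases hf : C.e x = false ∧ C'.e x = true
      · obtain ⟨u, hu, hw⟩ := h.exists_endWrite hmx hf.1 hf.2
        have h₁ : 1 ≤ ∑ u ∈ matchedSet m, ind (EndWrite G m C C' u x) := by
          rw [← ind_pos hw]
          exact Finset.single_le_sum (f := fun u => ind (EndWrite G m C C' u x))
            (fun _ _ => Nat.zero_le _) (by simpa [matchedSet] using hu)
        have h₂ := ind_le_one (m x = none ∧ C'.e x ≠ C.e x)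
        have h₃ := ind_le_one (m x = none ∧ C'.e x = true)
        omega
      · refine le_add_right ?_
        cases h₁ : C.e x <;> cases h₂ : C'.e x <;> simp_all [ind]
    · simp [ind, hmx]
  have hsum := Finset.sum_le_sum hx
  rw [Finset.sum_add_distrib, Finset.sum_add_distrib, ← Finset.mul_sum, Finset.sum_comm] at hsum
  have hu : ∀ u ∈ matchedSet m, ∑ x, ind (EndWrite G m C C' u x) +
      writes G m C' (S ∪ A) u (partner m u) ≤ writes G m C S u (partner m u) := fun u hu =>
    (Nat.add_le_add_right (sum_endWrite_le u) _).trans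
      (h.writes_step (partner_spec hm hu).1 (partner_spec hm hu).2 hI)
  have hsum' := Finset.sum_le_sum hu
  rw [Finset.sum_add_distrib] at hsum'
  unfold endPotential
  omega

theorem sum_adj_le [DecidableRel G.Adj] (P : V → Prop) :
    ∑ u ∈ matchedSet m, ∑ x, ind (G.Adj u x ∧ P x) ≤ G.maxDegree * ∑ x, ind (P x) := by
  rw [Finset.sum_comm, Finset.mul_sum]
  refine Finset.sum_le_sum fun x _ => ?_
  by_cases hP : P x
  · rw [ind_pos hP, mul_one]
    refine le_trans ?_ (G.degree_le_maxDegree x)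
    rw [← G.card_neighborFinset_eq_degree, Finset.card_eq_sum_ones]
    calc ∑ u ∈ matchedSet m, ind (G.Adj u x ∧ P x)
        ≤ ∑ u, ind (G.Adj u x ∧ P x) :=
          Finset.sum_le_sum_of_subset (Finset.subset_univ _)
      _ = ∑ u ∈ G.neighborFinset x, ind (G.Adj u x ∧ P x) := by
          refine (Finset.sum_subset (Finset.subset_univ _) fun u _ hu => ind_neg ?_).symm
          rw [SimpleGraph.mem_neighborFinset] at hu
          exact fun hc => hu hc.1.symm
      _ ≤ ∑ u ∈ G.neighborFinset x, 1 := Finset.sum_le_sum fun u _ => ind_le_one _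
  · simp [ind, hP]

/-- Bound on the number of executions of `Update`. -/
noncomputable def updatePotential (G : SimpleGraph V) [DecidableRel G.Adj] (m : V → Option V)
    (C : MMConfig V) (S : Set V) : ℕ :=
  ∑ u ∈ matchedSet m, outdated G m C u + G.maxDegree * endPotential G m C S

theorem Trans.updatePotential_step [DecidableRel G.Adj] (h : Trans G m C C' A)
    (hm : MaxMatchingOn G m) {S : Set V} (hI : MovedInv G m C S) :
    ∑ u ∈ matchedSet m, ind (u ∈ A ∧ guardUpdate G m C u) + updatePotential G m C' (S ∪ A) ≤
      updatePotential G m C S := by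
  have h₁ := Finset.sum_le_sum fun u (hu : u ∈ matchedSet m) =>
    h.outdated_step (partner_spec hm hu).1
  rw [Finset.sum_add_distrib, Finset.sum_add_distrib] at h₁
  have h₂ := sum_adj_le (G := G) (m := m) fun x => m x = none ∧ C'.e x ≠ C.e x
  have h₃ := Nat.mul_le_mul_left G.maxDegree (h.endPotential_step hm hI)
  rw [Nat.mul_add] at h₃
  unfold updatePotential
  omega

/-- Bound on the number of moves of matched vertices. -/
noncomputable def movePotential (G : SimpleGraph V) [DecidableRel G.Adj] (m : V → Option V)
    (C : MMConfig V) (S : Set V) : ℕ :=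
  ∑ u ∈ matchedSet m, moveBound G m C u (partner m u) + 22 * updatePotential G m C S

theorem Trans.movePotential_step [DecidableRel G.Adj] (h : Trans G m C C' A)
    (hm : MaxMatchingOn G m) {S : Set V} (hI : MovedInv G m C S) :
    ∑ u ∈ matchedSet m, ind (u ∈ A) + movePotential G m C' (S ∪ A) ≤ movePotential G m C S := by
  have h₁ := Finset.sum_le_sum fun u (hu : u ∈ matchedSet m) =>
    h.moveBound_step (partner_spec hm hu).1 (partner_spec hm hu).2
  rw [Finset.sum_add_distrib, Finset.sum_add_distrib, ← Finset.mul_sum, Finset.sum_add_distrib,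
    sum_partner hm fun u => ind (u ∈ A ∧ guardUpdate G m C u)] at h₁
  have h₂ := h.updatePotential_step hm hI
  unfold movePotential
  omega

theorem movePotential_le [DecidableRel G.Adj] (S : Set V) : movePotential G m C S ≤
    10 * muV m + 22 * (muV m + G.maxDegree * (6 * muV m + sigmaV m)) := by
  have hmu : muV m = (matchedSet m).card := rfl
  have h₁ : ∑ u ∈ matchedSet m, moveBound G m C u (partner m u) ≤ muV m * 10 := by
    rw [hmu, ← smul_eq_mul]
    exact Finset.sum_le_card_nsmul _ _ _ fun u _ => moveBound_le
  have h₂ : ∑ u ∈ matchedSet m, outdated G m C u ≤ muV m * 1 := by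
    rw [hmu, ← smul_eq_mul]
    exact Finset.sum_le_card_nsmul _ _ _ fun u _ => ind_le_one _
  have h₃ : ∑ u ∈ matchedSet m, writes G m C S u (partner m u) ≤ muV m * 3 := by
    rw [hmu, ← smul_eq_mul]
    exact Finset.sum_le_card_nsmul _ _ _ fun u _ => writes_le S
  have h₄ : ∑ x, ind (m x = none ∧ C.e x = true) ≤ sigmaV m := by
    rw [sigmaV, Finset.card_filter]
    exact Finset.sum_le_sum fun x _ => (ind_mono And.left).trans
      (by unfold ind; split_ifs <;> simp)
  have h₅ : endPotential G m C S ≤ 6 * muV m + sigmaV m := by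
    unfold endPotential
    omega
  have h₆ := Nat.mul_le_mul_left G.maxDegree h₅
  unfold movePotential updatePotential
  omega

/-- The vertices that have moved before time `i`. -/
def movedBefore (E : MMExecution G m) : ℕ → Set V
  | 0 => ∅
  | i + 1 => movedBefore E i ∪ E.act i

theorem movedInv (E : MMExecution G m) (i : ℕ) :
    MovedInv G m (E.cfg i) (movedBefore E i) := by
  induction i with
  | zero => exact fun u hu => absurd hu (Set.notMem_empty u)
  | succ i ih => exact (trans_of_execution E i).movedInv ih

theorem sum_moves_le [DecidableRel G.Adj] (hm : MaxMatchingOn G m) (E : MMExecution G m) (N : ℕ) :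
    ∑ i ∈ Finset.range N, ∑ u ∈ matchedSet m, ind (u ∈ E.act i) +
      movePotential G m (E.cfg N) (movedBefore E N) ≤ movePotential G m (E.cfg 0) ∅ := by
  induction N with
  | zero => simp [movedBefore]
  | succ N ih =>
    have := (trans_of_execution E N).movePotential_step hm (movedInv E N)
    rw [Finset.sum_range_succ, movedBefore]
    omega

theorem card_moves_le (E : MMExecution G m) (T : Finset (ℕ × V))
    (hT : ∀ q ∈ T, m q.2 ≠ none ∧ q.2 ∈ E.act q.1) :
    ∃ N, T.card ≤ ∑ i ∈ Finset.range N, ∑ u ∈ matchedSet m, ind (u ∈ E.act i) := by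
  refine ⟨T.sup Prod.fst + 1, ?_⟩
  rw [← Finset.sum_product', Finset.card_eq_sum_ones,
    Finset.sum_congr rfl fun q hq => (ind_pos (hT q hq).2).symm]
  refine Finset.sum_le_sum_of_subset fun q hq => ?_
  rw [Finset.mem_product, Finset.mem_range, Nat.lt_succ_iff]
  exact ⟨Finset.le_sup (f := Prod.fst) hq, by simpa [matchedSet] using (hT q hq).1⟩

end MaxMatch

/-- In any execution, matched vertices make at most `12μ(Δ(σ+6μ)+μ)` moves
in total. -/
theorem stmt5 {V : Type*} [Fintype V] [LinearOrder V]
    (G : SimpleGraph V) (m : V → Option V) (hm : MaxMatchingOn G m)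
    [DecidableRel G.Adj] (E : MMExecution G m) :
    ∀ T : Finset (ℕ × V),
      (∀ q ∈ T, m q.2 ≠ none ∧ q.2 ∈ E.act q.1) →
      T.card ≤ 12 * muV m * (G.maxDegree * (sigmaV m + 6 * muV m) + muV m) := by
  intro T hT
  rcases T.eq_empty_or_nonempty with rfl | ⟨q, hq⟩
  · simp
  obtain ⟨N, hN⟩ := MaxMatch.card_moves_le E T hT
  have hsum := MaxMatch.sum_moves_le hm E N
  have hpot := MaxMatch.movePotential_le (G := G) (m := m) (C := E.cfg 0) ∅
  obtain ⟨v, hv⟩ := Option.ne_none_iff_exists'.1 (hT q hq).1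
  have hadj := hm.adj _ _ hv
  have hmu : 2 ≤ muV m := by
    rw [← Finset.card_pair hadj.ne]
    refine Finset.card_le_card fun w hw => ?_
    rw [Finset.mem_insert, Finset.mem_singleton] at hw
    rcases hw with rfl | rfl <;> simp [hv, hm.symm _ _ hv]
  have hdeg : 1 ≤ G.maxDegree :=
    ((G.degree_pos_iff_exists_adj q.2).2 ⟨v, hadj⟩).trans_le (G.degree_le_maxDegree q.2)
  have h₁ := Nat.mul_le_mul_right (6 * muV m + sigmaV m) hdeg
  have h₂ := Nat.mul_le_mul_right
    (12 * (G.maxDegree * (sigmaV m + 6 * muV m) + muV m)) hmu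
  rw [Nat.add_comm (6 * muV m)] at h₁ hpot
  calc T.card ≤ 2 * (12 * (G.maxDegree * (sigmaV m + 6 * muV m) + muV m)) := by omega
    _ ≤ muV m * (12 * (G.maxDegree * (sigmaV m + 6 * muV m) + muV m)) := h₂
    _ = 12 * muV m * (G.maxDegree * (sigmaV m + 6 * muV m) + muV m) := by ring
end
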